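/- arXiv:0903.5352 — 7 statements merged into one kernel-verified Lean document; each statement's English description precedes it below -/
import Mathlib

section
/- Let k ≥ 1 be an integer and let G be a finite simple graph with n vertices containing no cycle of length 2k+2. Then for every vertex u of G, the sum over all neighbors v of u of d_G(v) is at most k·d_G(u) + k(n−1). -/
lemma List.isChain_append_of_getElem {α : Type*} {R : α → α → Prop} {l₁ l₂ : List α}
    (h₁ : l₁.IsChain R) (h₂ : l₂.IsChain R)
    (h : ∀ (h₁ : l₁.length - 1 < l₁.length) (h₂ : 0 < l₂.length), R l₁[l₁.length - 1] l₂[0]) :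
    (l₁ ++ l₂).IsChain R := by
  refine List.isChain_append.2 ⟨h₁, h₂, fun x hx y hy => ?_⟩
  rw [List.getLast?_eq_getElem?, Option.mem_def, List.getElem?_eq_some_iff] at hx
  rw [List.head?_eq_getElem?, Option.mem_def, List.getElem?_eq_some_iff] at hy
  obtain ⟨hx, rfl⟩ := hx
  obtain ⟨hy, rfl⟩ := hy
  exact h hx hy

lemma List.isChain_cons_of_getElem {α : Type*} {R : α → α → Prop} {a : α} {l : List α}
    (hl : l.IsChain R) (h : ∀ h : 0 < l.length, R a l[0]) : (a :: l).IsChain R :=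
  List.isChain_append_of_getElem (l₁ := [a]) (.singleton a) hl fun _ h₂ => h h₂

namespace SimpleGraph

variable {V : Type*} {G : SimpleGraph V} {A : Set V} {l : List V}

/-- The list `l` is the vertex sequence of a path of `G` whose two ends lie in `A`. -/
structure IsPathBetween (G : SimpleGraph V) (A : Set V) (l : List V) : Prop where
  nodup : l.Nodup
  chain : l.IsChain G.Adj
  ne_nil : l ≠ []
  head_mem : l.head ne_nil ∈ A
  last_mem : l.getLast ne_nil ∈ A

/-- The list `l` runs once around a cycle of `G`; a single edge counts as a cycle. -/
structure IsCyclicList (G : SimpleGraph V) (l : List V) : Prop where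
  nodup : l.Nodup
  chain : l.IsChain G.Adj
  ne_nil : l ≠ []
  closed : G.Adj (l.getLast ne_nil) (l.head ne_nil)

namespace IsPathBetween

lemma length_pos (h : IsPathBetween G A l) : 0 < l.length := List.length_pos_iff.2 h.ne_nil

lemma adj (h : IsPathBetween G A l) {i : ℕ} (hi : i + 1 < l.length) : G.Adj l[i] l[i + 1] :=
  List.isChain_iff_getElem.1 h.chain i hi

lemma getElem_zero_mem (h : IsPathBetween G A l) : l[0]'h.length_pos ∈ A := by
  have := h.head_mem
  rwa [List.head_eq_getElem] at this

lemma getElem_last_mem (h : IsPathBetween G A l) :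
    l[l.length - 1]'(Nat.sub_lt h.length_pos one_pos) ∈ A := by
  have := h.last_mem
  rwa [List.getLast_eq_getElem] at this

lemma reverse (h : IsPathBetween G A l) : IsPathBetween G A l.reverse where
  nodup := List.nodup_reverse.2 h.nodup
  chain := List.isChain_reverse.2 (h.chain.imp fun _ _ hab => hab.symm)
  ne_nil := by simpa using h.ne_nil
  head_mem := by simpa using h.last_mem
  last_mem := by simpa using h.head_mem

lemma cons (h : IsPathBetween G A l) {w : V} (hw : w ∈ A) (hwl : w ∉ l)
    (hadj : G.Adj w (l[0]'h.length_pos)) : IsPathBetween G A (w :: l) where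
  nodup := List.nodup_cons.2 ⟨hwl, h.nodup⟩
  chain := List.isChain_cons_of_getElem h.chain fun _ => hadj
  ne_nil := by simp
  head_mem := by simpa
  last_mem := by simpa [List.getLast_cons h.ne_nil] using h.last_mem

lemma cons_cons (h : IsPathBetween G A l) {w b : V} (hw : w ∈ A) (hwl : w ∉ l) (hb : b ∉ l)
    (hwb : G.Adj w b) (hadj : G.Adj b (l[0]'h.length_pos)) : IsPathBetween G A (w :: b :: l) where
  nodup := by grind [h.nodup, hwb.ne]
  chain := List.isChain_cons_of_getElem
    (List.isChain_cons_of_getElem h.chain fun _ => hadj) fun _ => hwb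
  ne_nil := by simp
  head_mem := by simpa
  last_mem := by simpa [List.getLast_cons h.ne_nil] using h.last_mem

lemma drop (h : IsPathBetween G A l) {i : ℕ} (hi : i < l.length) (hA : l[i] ∈ A) :
    IsPathBetween G A (l.drop i) where
  nodup := h.nodup.sublist (List.drop_sublist _ _)
  chain := h.chain.drop _
  ne_nil := by simpa
  head_mem := by simpa
  last_mem := by simpa using h.last_mem

lemma take (h : IsPathBetween G A l) {i : ℕ} (hi : i < l.length) (hA : l[i] ∈ A) :
    IsPathBetween G A (l.take (i + 1)) where
  nodup := h.nodup.sublist (List.take_sublist _ _)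
  chain := h.chain.take _
  ne_nil := by simpa using h.ne_nil
  head_mem := by simpa [List.head_take] using h.head_mem
  last_mem := by
    rw [List.getLast_eq_getElem]
    simpa [Nat.min_eq_left (show i + 1 ≤ l.length from hi)] using hA

lemma reverse_take_append_drop (h : IsPathBetween G A l) {i j : ℕ} (hji : j < i)
    (hi : i < l.length) (hadj : G.Adj (l[0]'h.length_pos) l[i])
    (hA : l[j] ∈ A) : IsPathBetween G A ((l.take (j + 1)).reverse ++ l.drop i) where
  nodup := by
    have := h.nodup
    rw [← List.take_append_drop i l, List.nodup_append] at this
    rw [List.nodup_append]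
    refine ⟨List.nodup_reverse.2 (h.nodup.sublist (List.take_sublist _ _)), this.2.1,
      fun a ha b hb => this.2.2 a ?_ b hb⟩
    exact (List.take_subset_take_left l (by omega)) (List.mem_reverse.1 ha)
  chain := by
    refine List.isChain_append_of_getElem
      (List.isChain_reverse.2 ((h.chain.take _).imp fun _ _ hab => hab.symm))
      (h.chain.drop _) fun h₁ h₂ => ?_
    simpa using hadj
  ne_nil := List.append_ne_nil_of_right_ne_nil _ (by simpa)
  head_mem := by grind
  last_mem := by have := h.last_mem; grind

lemma reverse_take_append_cons_drop (h : IsPathBetween G A l) {i : ℕ} {b : V}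
    (hi : i + 1 < l.length) (hb : b ∉ l) (hadj₀ : G.Adj (l[0]'h.length_pos) b)
    (hadj : G.Adj b l[i + 1]) (hA : l[i] ∈ A) :
    IsPathBetween G A ((l.take (i + 1)).reverse ++ b :: l.drop (i + 1)) where
  nodup := by
    have := h.nodup
    rw [← List.take_append_drop (i + 1) l, List.nodup_append] at this
    have h1 := List.take_subset (i + 1) l
    have h2 := List.drop_subset (i + 1) l
    rw [List.nodup_append, List.nodup_reverse, List.nodup_cons]
    grind
  chain := by
    refine List.isChain_append_of_getElem
      (List.isChain_reverse.2 ((h.chain.take _).imp fun _ _ hab => hab.symm))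
      (List.isChain_cons_of_getElem (h.chain.drop _) fun h₂ => ?_) fun h₁ h₂ => ?_
    · simpa using hadj
    · simpa using hadj₀
  ne_nil := by simp
  head_mem := by grind
  last_mem := by
    rw [List.getLast_append_of_ne_nil _ (by simp), List.getLast_cons (by simpa)]
    simpa using h.last_mem

lemma drop_append_cons_take (h : IsPathBetween G A l) {j : ℕ} {v : V}
    (hj : j + 1 < l.length) (hv : v ∉ l) (hadj₀ : G.Adj v (l[0]'h.length_pos))
    (hadj : G.Adj v (l[l.length - 1]'(Nat.sub_lt h.length_pos one_pos)))
    (hA : l[j] ∈ A) (hA' : l[j + 1] ∈ A) :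
    IsPathBetween G A (l.drop (j + 1) ++ v :: l.take (j + 1)) where
  nodup := by
    have := h.nodup
    rw [← List.take_append_drop (j + 1) l, List.nodup_append] at this
    have h1 := List.take_subset (j + 1) l
    have h2 := List.drop_subset (j + 1) l
    grind
  chain := by
    refine List.isChain_append_of_getElem (h.chain.drop _)
      (List.isChain_cons_of_getElem (h.chain.take _) fun h₂ => ?_) fun h₁ h₂ => ?_
    · simpa using hadj₀
    · have := hadj.symm
      simp only [List.length_drop, List.getElem_drop, List.getElem_cons_zero]
      convert this using 2
      omega
  ne_nil := by simp
  head_mem := by grind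
  last_mem := by grind

lemma exists_length_add_two (hAdj : ∀ x y, G.Adj x y → x ∈ A ∨ y ∈ A)
    (h : IsPathBetween G A l) (hl : 3 ≤ l.length) :
    ∃ l', IsPathBetween G A l' ∧ l'.length + 2 = l.length := by
  by_cases h1 : l[1] ∈ A
  · by_cases h2 : l[l.length - 2] ∈ A
    · refine ⟨(l.take (l.length - 2 + 1)).drop 1, (h.take (by omega) h2).drop (by grind) ?_, ?_⟩
      · simpa using h1
      · grind
    · have h3 : l[l.length - 3] ∈ A := by
        have := hAdj _ _ (h.adj (i := l.length - 3) (by omega))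
        grind
      exact ⟨_, h.take (by omega) h3, by grind⟩
  · have h3 : l[2] ∈ A := by
      have := hAdj _ _ (h.adj (i := 1) (by omega))
      grind
    exact ⟨_, h.drop (by omega) h3, by grind⟩

lemma exists_length_eq (hAdj : ∀ x y, G.Adj x y → x ∈ A ∨ y ∈ A) {n : ℕ} (hn : 1 ≤ n) :
    ∀ (m : ℕ) (l : List V), IsPathBetween G A l → l.length = n + 2 * m →
      ∃ l', IsPathBetween G A l' ∧ l'.length = n
  | 0, l, h, hl => ⟨l, h, by simpa using hl⟩
  | m + 1, l, h, hl => by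
    obtain ⟨l', h', hl'⟩ := h.exists_length_add_two hAdj (by omega)
    exact exists_length_eq hAdj hn m l' h' (by omega)

end IsPathBetween

namespace IsCyclicList

lemma drop_append_take (h : IsCyclicList G l) (i : ℕ) : IsCyclicList G (l.drop i ++ l.take i) := by
  have hn := h.nodup
  have hc := h.chain
  have hcl := h.closed
  have hne := h.ne_nil
  rw [← List.take_append_drop i l, List.nodup_append] at hn
  by_cases hi : 0 < i ∧ i < l.length
  · refine ⟨List.nodup_append.2 ⟨hn.2.1, hn.1, by grind⟩, ?_,
      List.append_ne_nil_of_left_ne_nil (by simpa using hi.2) _, ?_⟩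
    · refine List.isChain_append_of_getElem (hc.drop _) (hc.take _) fun h₁ h₂ => ?_
      rw [List.getLast_eq_getElem, List.head_eq_getElem] at hcl
      simp only [List.length_drop, List.getElem_drop, List.getElem_take]
      convert hcl using 2
      omega
    · have h1 := List.isChain_iff_getElem.1 hc (i - 1) (by omega)
      grind
  · rcases Nat.eq_zero_or_pos i with rfl | hi0
    · simpa using h
    · have hi' : l.length ≤ i := by omega
      simpa [List.drop_eq_nil_of_le hi', List.take_of_length_le hi'] using h

lemma reverse (h : IsCyclicList G l) : IsCyclicList G l.reverse where
  nodup := List.nodup_reverse.2 h.nodup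
  chain := List.isChain_reverse.2 (h.chain.imp fun _ _ hab => hab.symm)
  ne_nil := by simpa using h.ne_nil
  closed := by simpa using h.closed.symm

end IsCyclicList

lemma _root_.Finset.two_mul_card_le_of_succ_notMem {M : Finset ℕ} {n : ℕ}
    (hn : ∀ i ∈ M, i < n) (hM : ∀ i ∈ M, i + 1 ∉ M) : 2 * M.card ≤ n + 1 := by
  have hdisj : Disjoint M (M.image (· + 1)) := by
    rw [Finset.disjoint_left]
    intro i hi hi'
    obtain ⟨j, hj, rfl⟩ := Finset.mem_image.1 hi'
    exact hM j hj hi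
  have hsub : M ∪ M.image (· + 1) ⊆ Finset.range (n + 1) := by
    intro i hi
    grind
  have := Finset.card_le_card hsub
  rw [Finset.card_union_of_disjoint hdisj, Finset.card_image_of_injective _ (add_left_injective 1),
    Finset.card_range] at this
  omega

lemma _root_.Finset.card_le_card_of_forall_getElem {α : Type*} {l : List α} {s : Finset α}
    {N : Finset ℕ} (h : ∀ x ∈ s, ∃ i ∈ N, ∃ hi : i < l.length, l[i] = x) : s.card ≤ N.card := by
  classical
  rcases l with _ | ⟨a, l⟩
  · have : s = ∅ := Finset.eq_empty_of_forall_notMem fun x hx => by simpa using h x hx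
    simp [this]
  · refine Finset.card_le_card_of_surjOn (fun i => (a :: l).getD i a) fun x hx => ?_
    obtain ⟨i, hi, hil, rfl⟩ := h x hx
    exact ⟨i, hi, List.getD_eq_getElem _ _ hil⟩

/-- The positions in `l` of the vertices satisfying `P`. -/
noncomputable def positions (l : List V) (P : V → Prop) : Finset ℕ := by
  classical exact (Finset.range l.length).filter fun i => ∃ h : i < l.length, P l[i]

lemma mem_positions {P : V → Prop} {i : ℕ} :
    i ∈ positions l P ↔ ∃ h : i < l.length, P l[i] := by
  classical
  simp only [positions, Finset.mem_filter, Finset.mem_range]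
  exact ⟨And.right, fun h => ⟨h.1, h⟩⟩

lemma card_le_card_positions {P : V → Prop} {s : Finset V} (hs : ∀ x ∈ s, P x ∧ x ∈ l) :
    s.card ≤ (positions l P).card := by
  refine Finset.card_le_card_of_forall_getElem (l := l) fun x hx => ?_
  obtain ⟨hP, hl⟩ := hs x hx
  obtain ⟨i, hi, rfl⟩ := List.getElem_of_mem hl
  exact ⟨i, mem_positions.2 ⟨hi, hP⟩, hi, rfl⟩

namespace IsPathBetween

lemma two_mul_card_le_of_pred_notMem (hAdj : ∀ x y, G.Adj x y → x ∈ A ∨ y ∈ A)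
    (h : IsPathBetween G A l) {N : Finset ℕ} (hN : ∀ i ∈ N, i < l.length)
    (hpred : ∀ i (hi : i < l.length), i + 1 ∈ N → l[i] ∉ A) : 2 * N.card ≤ l.length + 1 := by
  refine Finset.two_mul_card_le_of_succ_notMem hN fun i hi hi' => ?_
  have h1 := hpred i (hN i hi) hi'
  rcases i with _ | i
  · exact h1 h.getElem_zero_mem
  · have h2 := hpred i (by have := hN _ hi; omega) hi
    rcases hAdj _ _ (h.adj (hN _ hi)) with h | h
    exacts [h2 h, h1 h]

lemma notMem_of_adj_of_adj (h : IsPathBetween G A l) {b : V}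
    (hlen : ∀ l', IsPathBetween G A l' → l'.length ≠ l.length + 1) (hb : b ∉ l)
    (hadj₀ : G.Adj (l[0]'h.length_pos) b) {i : ℕ} (hi : i + 1 < l.length)
    (hadj : G.Adj b l[i + 1]) : l[i] ∉ A := fun hA =>
  hlen _ (h.reverse_take_append_cons_drop hi hb hadj₀ hadj hA) (by simp; omega)

/-- A long path with ends in `A` cannot have an even number of vertices when no path with ends
in `A` has `2k+1` or `2k+3` vertices: such a path, chosen with its edge inside `A` as far from its
first end as possible, has all neighbours of the first end on it, and these are too few. -/
lemma false_of_length_eq_even {k : ℕ}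
    (hAdj : ∀ x y, G.Adj x y → x ∈ A ∨ y ∈ A)
    (hB : ∀ v ∉ A, ∃ s : Finset V, (∀ x ∈ s, G.Adj v x) ∧ k + 1 ≤ s.card)
    (hA : ∀ v ∈ A, ∃ s t : Finset V, (∀ x ∈ s, G.Adj v x) ∧ (∀ x ∈ t, G.Adj v x ∧ x ∈ A) ∧
      2 * k ≤ s.card + t.card)
    (hk : 1 ≤ k) (hodd : ∀ l, IsPathBetween G A l → l.length ≠ 2 * k + 1)
    (hodd' : ∀ l, IsPathBetween G A l → l.length ≠ 2 * k + 3) :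
    ∀ (m : ℕ) (l : List V), IsPathBetween G A l → l.length = 2 * k + 2 →
      ∀ (j : ℕ) (hj : j + 1 < l.length), l[j] ∈ A → l[j + 1] ∈ A → 2 * k + 2 - j ≤ m → False
  | 0, l, h, hl, j, hj, hj1, hj2, hm => by omega
  | m + 1, l, h, hl, j, hj, hj1, hj2, hm => by
    have hsecond : l[1] ∉ A := fun hc => hodd _ (h.drop (by omega) hc) (by simp; omega)
    have hpenult : l[2 * k] ∉ A := fun hc => hodd _ (h.take (by omega) hc) (by simp; omega)
    have hk2 : 2 ≤ k := by
      by_contra hk2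
      obtain rfl : k = 1 := by omega
      have := hAdj _ _ (h.adj (i := 1) (by omega))
      simp_all
    have hthird : l[2] ∈ A := (hAdj _ _ (h.adj (i := 1) (by omega))).resolve_left hsecond
    have hante : l[2 * k - 1] ∈ A := by
      have h1 := hAdj _ _ (h.adj (i := 2 * k - 1) (by omega))
      simp only [show 2 * k - 1 + 1 = 2 * k by omega] at h1
      exact h1.resolve_right hpenult
    have hlast := h.getElem_last_mem
    have hzero := h.getElem_zero_mem
    have hj' : j + 1 < 2 * k := by
      rcases lt_trichotomy (j + 1) (2 * k) with h1 | h1 | h1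
      · exact h1
      · simp [h1, hpenult] at hj2
      · obtain rfl : j = 2 * k := by omega
        exact absurd hj1 hpenult
    have hlen : ∀ l', IsPathBetween G A l' → l'.length ≠ l.length + 1 := fun l' h' => by
      have := hodd' l' h'
      omega
    have hnbr : ∀ b, G.Adj l[0] b → b ∈ l := by
      intro b hb
      by_contra hbl
      have hbA : b ∉ A := fun hc => hlen _ (h.cons hc hbl hb.symm) (by simp)
      have hbnbr : ∀ x, G.Adj b x → x ∈ l := by
        intro x hx
        by_contra hxl
        have hxA : x ∈ A := (hAdj _ _ hx).resolve_left hbA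
        have htake := h.take (i := 2 * k - 1) (by omega) hante
        refine false_of_length_eq_even hAdj hB hA hk hodd hodd' m _
          (htake.cons_cons (w := x) (b := b) hxA ?_ ?_ hx.symm ?_) ?_ (j + 2) ?_ ?_ ?_ ?_
        · exact fun hc => hxl (List.take_subset _ _ hc)
        · exact fun hc => hbl (List.take_subset _ _ hc)
        · simpa using hb.symm
        · simp; omega
        · simp; omega
        · simpa using hj1
        · simpa using hj2
        · omega
      have hblast : ¬ G.Adj b (l[l.length - 1]'(Nat.sub_lt h.length_pos one_pos)) := fun hc =>
        hlen _ (h.drop_append_cons_take hj hbl hb.symm hc hj1 hj2) (by simp; omega)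
      obtain ⟨s, hs, hscard⟩ := hB b hbA
      have h1 : s.card ≤ (positions l (G.Adj b)).card :=
        card_le_card_positions fun x hx => ⟨hs x hx, hbnbr x (hs x hx)⟩
      have hnot : 2 * k + 1 ∉ positions l (G.Adj b) := fun hc => by
        obtain ⟨_, hc⟩ := mem_positions.1 hc
        exact hblast (by simpa [hl] using hc)
      have h2 := h.two_mul_card_le_of_pred_notMem hAdj
        (N := insert (2 * k + 1) (positions l (G.Adj b)))
        (fun i hi => by
          rcases Finset.mem_insert.1 hi with rfl | hi
          · omega
          · exact (mem_positions.1 hi).1)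
        (fun i hi hi' => by
          rcases Finset.mem_insert.1 hi' with hi' | hi'
          · obtain rfl : i = 2 * k := by omega
            exact hpenult
          · obtain ⟨h3, h4⟩ := mem_positions.1 hi'
            exact h.notMem_of_adj_of_adj hlen hbl hb h3 h4)
      rw [Finset.card_insert_of_notMem hnot] at h2
      omega
    have hskip : ∀ i (hi : i + 2 < l.length), G.Adj l[0] l[i + 2] → l[i] ∉ A := fun i hi hadj hc =>
      hodd _ (h.reverse_take_append_drop (by omega) hi hadj hc) (by simp; omega)
    obtain ⟨s, t, hs, ht, hst⟩ := hA _ hzero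
    have hs' := card_le_card_positions (l := l) fun x hx => ⟨hs x hx, hnbr x (hs x hx)⟩
    have ht' := card_le_card_positions (l := l) fun x hx => ⟨ht x hx, hnbr x (ht x hx).1⟩
    set S := positions l (G.Adj l[0]) with hS
    set T := positions l (fun x => G.Adj l[0] x ∧ x ∈ A) with hT
    have hS2 : ∀ i ∈ S.erase 1, 3 ≤ i ∧ ∃ hi : i < l.length, G.Adj l[0] l[i] := by
      intro i hi
      obtain ⟨hi1, hi⟩ := Finset.mem_erase.1 hi
      obtain ⟨hil, hadj⟩ := mem_positions.1 hi
      refine ⟨?_, hil, hadj⟩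
      by_contra hlt
      have : i = 0 ∨ i = 2 := by omega
      rcases this with rfl | rfl
      · exact G.irrefl hadj
      · exact hskip 0 _ hadj hzero
    have hT2 : ∀ i ∈ T, i ∈ S.erase 1 ∧ ∃ hi : i < l.length, l[i] ∈ A := by
      intro i hi
      obtain ⟨hil, hadj, hiA⟩ := mem_positions.1 hi
      refine ⟨Finset.mem_erase.2 ⟨?_, mem_positions.2 ⟨hil, hadj⟩⟩, hil, hiA⟩
      rintro rfl
      exact hsecond hiA
    have hS3 : ∀ i (hi : i + 1 ∈ S.erase 1), ∃ hi : i < l.length, l[i] ∈ A := by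
      intro i hi
      obtain ⟨h3, hil, hadj⟩ := hS2 _ hi
      obtain ⟨i, rfl⟩ : ∃ i', i = i' + 1 := ⟨i - 1, by omega⟩
      exact ⟨by omega, (hAdj _ _ (h.adj (by omega))).resolve_left (hskip i hil hadj)⟩
    have hT3 : ∀ i (hi : i + 2 ∈ T), ∃ hi : i < l.length, l[i] ∉ A := by
      intro i hi
      obtain ⟨h3, hil, hadj⟩ := hS2 _ (hT2 _ hi).1
      exact ⟨by omega, hskip i hil hadj⟩
    have hcardS : ((S.erase 1).image (· - 1)).card = (S.erase 1).card :=
      Finset.card_image_of_injOn fun x hx y hy hxy => by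
        have := (hS2 x hx).1
        have := (hS2 y hy).1
        omega
    have hcardT : (T.image (· - 2)).card = T.card :=
      Finset.card_image_of_injOn fun x hx y hy hxy => by
        have := (hS2 x (hT2 x hx).1).1
        have := (hS2 y (hT2 y hy).1).1
        omega
    have hdisj : Disjoint ((S.erase 1).image (· - 1)) (T.image (· - 2)) := by
      rw [Finset.disjoint_left]
      intro i hi hi'
      obtain ⟨x, hx, rfl⟩ := Finset.mem_image.1 hi
      obtain ⟨y, hy, hxy⟩ := Finset.mem_image.1 hi'
      have hx3 := (hS2 x hx).1
      have hy3 := (hS2 y (hT2 y hy).1).1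
      obtain ⟨_, h1⟩ := hS3 (x - 1) (by rwa [show x - 1 + 1 = x by omega])
      obtain ⟨_, h2⟩ := hT3 (y - 2) (by rwa [show y - 2 + 2 = y by omega])
      simp only [hxy] at h2
      exact h2 h1
    obtain ⟨q, hq, hqS⟩ : ∃ q ∈ Finset.Icc 1 (2 * k - 1),
        ∀ i ∈ (S.erase 1).image (· - 1) ∪ T.image (· - 2), i ≠ q := by
      by_cases hfour : l[3] ∈ A
      · refine ⟨3, by simp; omega, ?_⟩
        rintro i hi rfl
        rcases Finset.mem_union.1 hi with hi | hi
        · obtain ⟨x, hx, hx'⟩ := Finset.mem_image.1 hi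
          obtain rfl : x = 4 := by omega
          obtain ⟨_, hil, hadj⟩ := hS2 _ hx
          exact hskip 2 hil hadj hthird
        · obtain ⟨x, hx, hx'⟩ := Finset.mem_image.1 hi
          obtain rfl : x = 5 := by omega
          exact (hT3 3 hx).2 hfour
      · refine ⟨1, by simp; omega, ?_⟩
        rintro i hi rfl
        rcases Finset.mem_union.1 hi with hi | hi
        · obtain ⟨x, hx, hx'⟩ := Finset.mem_image.1 hi
          have := (hS2 x hx).1
          omega
        · obtain ⟨x, hx, hx'⟩ := Finset.mem_image.1 hi
          obtain rfl : x = 3 := by omega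
          exact hfour (hT2 3 hx).2.2
    have hsub : (S.erase 1).image (· - 1) ∪ T.image (· - 2) ⊆
        (Finset.Icc 1 (2 * k - 1)).erase q := by
      intro i hi
      refine Finset.mem_erase.2 ⟨hqS i hi, Finset.mem_Icc.2 ?_⟩
      rcases Finset.mem_union.1 hi with hi | hi
      · obtain ⟨x, hx, rfl⟩ := Finset.mem_image.1 hi
        obtain ⟨h3, hxl, _⟩ := hS2 x hx
        obtain ⟨_, h5⟩ := hS3 (x - 1) (by rwa [show x - 1 + 1 = x by omega])
        have : x - 1 ≠ 2 * k := fun hc => by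
          simp only [hc] at h5
          exact hpenult h5
        omega
      · obtain ⟨x, hx, rfl⟩ := Finset.mem_image.1 hi
        obtain ⟨h3, hxl, hadj⟩ := hS2 x (hT2 x hx).1
        omega
    have hcard := Finset.card_le_card hsub
    rw [Finset.card_union_of_disjoint hdisj, hcardS, hcardT, Finset.card_erase_of_mem hq,
      Nat.card_Icc] at hcard
    have := Finset.pred_card_le_card_erase (s := S) (a := 1)
    omega

end IsPathBetween

lemma card_positions_add_card_positions_not (P : V → Prop) :
    (positions l P).card + (positions l fun x => ¬ P x).card = l.length := by
  have hdisj : Disjoint (positions l P) (positions l fun x => ¬ P x) := by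
    rw [Finset.disjoint_left]
    intro i hi hi'
    obtain ⟨_, h1⟩ := mem_positions.1 hi
    obtain ⟨_, h2⟩ := mem_positions.1 hi'
    exact h2 h1
  classical
  have hunion : positions l P ∪ positions l (fun x => ¬ P x) = Finset.range l.length := by
    ext i
    simp only [Finset.mem_union, mem_positions, Finset.mem_range]
    constructor
    · rintro (⟨h, _⟩ | ⟨h, _⟩) <;> exact h
    · intro h
      by_cases hP : P l[i]
      exacts [.inl ⟨h, hP⟩, .inr ⟨h, hP⟩]
  rw [← Finset.card_union_of_disjoint hdisj, hunion, Finset.card_range]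

lemma exists_succ_of_lt_two_mul_card_positions {P : V → Prop}
    (h : l.length + 1 < 2 * (positions l P).card) :
    ∃ (j : ℕ) (hj : j + 1 < l.length), P l[j] ∧ P l[j + 1] := by
  by_contra! hno
  have := Finset.two_mul_card_le_of_succ_notMem (M := positions l P)
    (fun i hi => (mem_positions.1 hi).1) fun i hi hi' => by
      obtain ⟨_, h1⟩ := mem_positions.1 hi
      obtain ⟨h3, h2⟩ := mem_positions.1 hi'
      exact hno i h3 h1 h2
  omega

namespace IsCyclicList

lemma length_pos (h : IsCyclicList G l) : 0 < l.length := List.length_pos_iff.2 h.ne_nil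

lemma isPathBetween (h : IsCyclicList G l) (h₀ : l[0]'h.length_pos ∈ A)
    (h₁ : l[l.length - 1]'(Nat.sub_lt h.length_pos one_pos) ∈ A) : IsPathBetween G A l where
  nodup := h.nodup
  chain := h.chain
  ne_nil := h.ne_nil
  head_mem := by rwa [List.head_eq_getElem]
  last_mem := by rwa [List.getLast_eq_getElem]

lemma closed_getElem (h : IsCyclicList G l) :
    G.Adj (l[l.length - 1]'(Nat.sub_lt h.length_pos one_pos)) (l[0]'h.length_pos) := by
  have := h.closed
  rwa [List.head_eq_getElem, List.getLast_eq_getElem] at this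

lemma take (hAdj : ∀ x y, G.Adj x y → x ∈ A ∨ y ∈ A) (h : IsCyclicList G l)
    (h₁ : l[l.length - 1]'(Nat.sub_lt h.length_pos one_pos) ∉ A) :
    2 ≤ l.length ∧ IsPathBetween G A (l.take (l.length - 1)) := by
  have hpos := h.length_pos
  have hzero : l[0] ∈ A := (hAdj _ _ h.closed_getElem).resolve_left h₁
  have hlen : 2 ≤ l.length := by
    by_contra hlt
    simp only [show l.length - 1 = 0 by omega] at h₁
    exact h₁ hzero
  have hadj := List.isChain_iff_getElem.1 h.chain (l.length - 2) (by omega)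
  simp only [show l.length - 2 + 1 = l.length - 1 by omega] at hadj
  have h₂ := (hAdj _ _ hadj).resolve_right h₁
  refine ⟨hlen, h.nodup.sublist (List.take_sublist _ _), h.chain.take _, ?_, ?_, ?_⟩
  · rw [← List.length_pos_iff]
    simp; omega
  · rw [List.head_eq_getElem]
    simpa using hzero
  · rw [List.getLast_eq_getElem]
    simp only [List.getElem_take, List.length_take]
    convert h₂ using 2
    omega

lemma getElem_zero_rotate {i : ℕ} (hi : i < l.length) (h : 0 < (l.drop i ++ l.take i).length) :
    (l.drop i ++ l.take i)[0] = l[i] := by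
  rw [List.getElem_append_left (by simpa using hi)]
  simp

lemma getElem_last_rotate {i : ℕ} (hi : i + 1 < l.length)
    (h : (l.drop (i + 1) ++ l.take (i + 1)).length - 1 <
      (l.drop (i + 1) ++ l.take (i + 1)).length) :
    (l.drop (i + 1) ++ l.take (i + 1))[(l.drop (i + 1) ++ l.take (i + 1)).length - 1] = l[i] := by
  rw [List.getElem_append_right (by simp; omega)]
  simp only [List.getElem_take]
  congr 1
  simp
  omega

end IsCyclicList

namespace IsPathBetween

lemma two_mul_card_positions_notMem_lt (hAdj : ∀ x y, G.Adj x y → x ∈ A ∨ y ∈ A)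
    (h : IsPathBetween G A l) : 2 * (positions l (· ∉ A)).card + 1 ≤ l.length := by
  have hinj := Finset.card_image_of_injective (positions l (· ∉ A)) (add_left_injective 1)
  have hpos := h.length_pos
  have := h.two_mul_card_le_of_pred_notMem hAdj
    (N := insert 0 ((positions l (· ∉ A)).image (· + 1)))
    (fun i hi => by
      rcases Finset.mem_insert.1 hi with rfl | hi
      · exact hpos
      · obtain ⟨j, hj, rfl⟩ := Finset.mem_image.1 hi
        obtain ⟨hjl, hjA⟩ := mem_positions.1 hj
        by_contra hlt
        obtain rfl : j = l.length - 1 := by omega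
        exact hjA h.getElem_last_mem)
    (fun i hi hi' => by
      obtain ⟨j, hj, hji⟩ := Finset.mem_image.1 ((Finset.mem_insert.1 hi').resolve_left (by omega))
      obtain rfl : j = i := by simpa using hji
      exact (mem_positions.1 hj).2)
  rw [Finset.card_insert_of_notMem (by simp)] at this
  omega

lemma mem_of_adj_head {k : ℕ} (hAdj : ∀ x y, G.Adj x y → x ∈ A ∨ y ∈ A)
    (hB : ∀ v ∉ A, ∃ s : Finset V, (∀ x ∈ s, G.Adj v x) ∧ k + 1 ≤ s.card)
    (h : IsPathBetween G A l) (hl : l.length ≤ 2 * k)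
    (hmax : ∀ l', IsPathBetween G A l' → l'.length ≤ l.length) {b : V}
    (hb : G.Adj (l[0]'h.length_pos) b) : b ∈ l := by
  by_contra hbl
  have hlen : ∀ l', IsPathBetween G A l' → l'.length ≠ l.length + 1 := fun l' h' => by
    have := hmax l' h'
    omega
  have hbA : b ∉ A := fun hc => hlen _ (h.cons hc hbl hb.symm) (by simp)
  obtain ⟨s, hs, hscard⟩ := hB b hbA
  have h1 : s.card ≤ (positions l (G.Adj b)).card := by
    refine card_le_card_positions fun x hx => ⟨hs x hx, ?_⟩
    by_contra hxl
    have := hmax _ (h.cons_cons ((hAdj _ _ (hs x hx)).resolve_left hbA) hxl hbl (hs x hx).symm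
      hb.symm)
    simp at this
  have h2 := h.two_mul_card_le_of_pred_notMem hAdj (N := positions l (G.Adj b))
    (fun i hi => (mem_positions.1 hi).1)
    (fun i hi hi' => by
      obtain ⟨h3, h4⟩ := mem_positions.1 hi'
      exact h.notMem_of_adj_of_adj hlen hbl hb h3 h4)
  omega

lemma exists_isCyclicList {k : ℕ} (h : IsPathBetween G A l)
    (hA : ∀ v ∈ A, ∃ s t : Finset V, (∀ x ∈ s, G.Adj v x) ∧ (∀ x ∈ t, G.Adj v x ∧ x ∈ A) ∧
      2 * k ≤ s.card + t.card)
    (hl : l.length ≤ 2 * k) (hhead : ∀ b, G.Adj (l[0]'h.length_pos) b → b ∈ l)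
    (hlast : ∀ b, G.Adj (l[l.length - 1]'(Nat.sub_lt h.length_pos one_pos)) b → b ∈ l) :
    ∃ c, IsCyclicList G c ∧ c.Perm l := by
  have hpos := h.length_pos
  obtain ⟨s, t, hs, ht, hst⟩ := hA _ h.getElem_zero_mem
  obtain ⟨s', t', hs', ht', hst'⟩ := hA _ h.getElem_last_mem
  set S := positions l (G.Adj l[0]) with hS
  set T := positions l (G.Adj l[l.length - 1]) with hT
  have h1 : s.card ≤ S.card := card_le_card_positions fun x hx => ⟨hs x hx, hhead x (hs x hx)⟩
  have h2 : t.card ≤ S.card :=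
    card_le_card_positions fun x hx => ⟨(ht x hx).1, hhead x (ht x hx).1⟩
  have h3 : s'.card ≤ T.card := card_le_card_positions fun x hx => ⟨hs' x hx, hlast x (hs' x hx)⟩
  have h4 : t'.card ≤ T.card :=
    card_le_card_positions fun x hx => ⟨(ht' x hx).1, hlast x (ht' x hx).1⟩
  have hT1 : ∀ i ∈ T, i + 1 < l.length := fun i hi => by
    obtain ⟨hil, hadj⟩ := mem_positions.1 hi
    by_contra hlt
    obtain rfl : i = l.length - 1 := by omega
    exact G.irrefl hadj
  obtain ⟨i, hiT, hiS⟩ : ∃ i ∈ T, i + 1 ∈ S := by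
    by_contra! hno
    have hdisj : Disjoint S (T.image (· + 1)) := by
      rw [Finset.disjoint_left]
      intro i hi hi'
      obtain ⟨j, hj, rfl⟩ := Finset.mem_image.1 hi'
      exact hno j hj hi
    have hsub : S ∪ T.image (· + 1) ⊆ Finset.Ico 1 l.length := by
      intro i hi
      rw [Finset.mem_Ico]
      rcases Finset.mem_union.1 hi with hi | hi
      · obtain ⟨hil, hadj⟩ := mem_positions.1 hi
        refine ⟨Nat.one_le_iff_ne_zero.2 ?_, hil⟩
        rintro rfl
        exact G.irrefl hadj
      · obtain ⟨j, hj, rfl⟩ := Finset.mem_image.1 hi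
        exact ⟨by omega, hT1 j hj⟩
    have := Finset.card_le_card hsub
    rw [Finset.card_union_of_disjoint hdisj, Nat.card_Ico,
      Finset.card_image_of_injective _ (add_left_injective 1)] at this
    omega
  obtain ⟨hi1, hadj⟩ := mem_positions.1 hiS
  obtain ⟨hi0, hadj'⟩ := mem_positions.1 hiT
  have hperm : ((l.take (i + 1)).reverse ++ l.drop (i + 1)).Perm l := by
    conv_rhs => rw [← List.take_append_drop (i + 1) l]
    exact (List.reverse_perm _).append_right _
  have hne : (l.take (i + 1)).reverse ++ l.drop (i + 1) ≠ [] :=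
    List.append_ne_nil_of_right_ne_nil _ (by simpa)
  refine ⟨_, ⟨hperm.nodup_iff.2 h.nodup, ?_, hne, ?_⟩, hperm⟩
  · refine List.isChain_append_of_getElem
      (List.isChain_reverse.2 ((h.chain.take _).imp fun _ _ hab => hab.symm))
      (h.chain.drop _) fun h₁ h₂ => ?_
    simpa using hadj
  · rw [List.getLast_append_of_ne_nil _ (by simpa), List.getLast_drop, List.getLast_eq_getElem,
      List.head_eq_getElem, List.getElem_append_left (by simp; omega), List.getElem_reverse]
    simp only [List.getElem_take]
    convert hadj' using 2
    simp; omega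

end IsPathBetween

lemma card_positions_le_of_subset {r : List V} {P : V → Prop} (hc : r.Nodup) (hsub : r ⊆ l) :
    (positions r P).card ≤ (positions l P).card := by
  classical
  rcases r with _ | ⟨a, r⟩
  · simp [positions]
  · have hget : ∀ i (hi : i < (a :: r).length), (a :: r).getD i a = (a :: r)[i] := fun i hi =>
      List.getD_eq_getElem _ _ hi
    rw [← Finset.card_image_of_injOn (s := positions (a :: r) P)
      (f := fun i => (a :: r).getD i a)]
    · refine card_le_card_positions fun x hx => ?_
      obtain ⟨i, hi, rfl⟩ := Finset.mem_image.1 hx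
      obtain ⟨hil, hP⟩ := mem_positions.1 hi
      rw [hget i hil]
      exact ⟨hP, hsub (List.getElem_mem hil)⟩
    · intro i hi j hj hij
      obtain ⟨hil, -⟩ := mem_positions.1 (Finset.mem_coe.1 hi)
      obtain ⟨hjl, -⟩ := mem_positions.1 (Finset.mem_coe.1 hj)
      simp only [hget i hil, hget j hjl] at hij
      exact (hc.getElem_inj_iff).1 hij

namespace IsCyclicList

lemma cons (h : IsCyclicList G l) {v : V} (hv : v ∈ A) (hvl : v ∉ l)
    (hadj : G.Adj v (l[0]'h.length_pos))
    (hlast : l[l.length - 1]'(Nat.sub_lt h.length_pos one_pos) ∈ A) :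
    IsPathBetween G A (v :: l) where
  nodup := List.nodup_cons.2 ⟨hvl, h.nodup⟩
  chain := List.isChain_cons_of_getElem h.chain fun _ => hadj
  ne_nil := by simp
  head_mem := by simpa
  last_mem := by rwa [List.getLast_cons h.ne_nil, List.getLast_eq_getElem]

/-- If the vertices of a longest path with ends in `A` can be arranged in a cycle, then no vertex
of `A` outside the cycle is adjacent to it. -/
lemma false_of_adj_of_mem {k : ℕ} (hAdj : ∀ x y, G.Adj x y → x ∈ A ∨ y ∈ A)
    (hA : ∀ v ∈ A, ∃ s t : Finset V, (∀ x ∈ s, G.Adj v x) ∧ (∀ x ∈ t, G.Adj v x ∧ x ∈ A) ∧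
      2 * k ≤ s.card + t.card)
    (h : IsPathBetween G A l) (hl : l.length ≤ 2 * k)
    (hmax : ∀ l', IsPathBetween G A l' → l'.length ≤ l.length)
    (hhead : ∀ q (hq : IsPathBetween G A q), q.length = l.length →
      ∀ b, G.Adj (q[0]'hq.length_pos) b → b ∈ q)
    {r : List V} (hc : IsCyclicList G r) (hperm : r.Perm l) {v : V} (hvc : v ∉ r)
    (hadj : G.Adj v (r[0]'hc.length_pos)) (hv : v ∈ A) : False := by
  have hpos := hc.length_pos
  have hlast : ∀ R (hR : IsCyclicList G R), R.Perm r → G.Adj v (R[0]'hR.length_pos) →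
      R[R.length - 1]'(Nat.sub_lt hR.length_pos one_pos) ∉ A := fun R hR hRc hRv hmem => by
    have := hmax _ (hR.cons hv (fun hm => hvc (hRc.mem_iff.1 hm)) hRv hmem)
    simp [hRc.length_eq, hperm.length_eq] at this
  have hclast := hlast r hc (.refl r) hadj
  obtain ⟨hlen, hpath⟩ := hc.take hAdj hclast
  have hL := hpath.cons hv (fun hm => hvc (List.take_subset _ _ hm)) (by simpa using hadj)
  have hnbr : ∀ b, G.Adj v b → b ∈ r := fun b hb => by
    have := hhead _ hL (by simp [← hperm.length_eq]; omega) b (by simpa using hb)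
    rcases List.mem_cons.1 this with rfl | hm
    exacts [(G.irrefl hb).elim, List.take_subset _ _ hm]
  have hsucc : (positions r (G.Adj v)).image (· + 1) ⊆ positions r (· ∉ A) := by
    intro j hj
    obtain ⟨i, hi, rfl⟩ := Finset.mem_image.1 hj
    obtain ⟨hil, hvi⟩ := mem_positions.1 hi
    have hi1 : i + 1 < r.length := by
      by_contra hi1
      obtain rfl : i = r.length - 1 := by omega
      have h1 := hlast _ hc.reverse r.reverse_perm (by simpa using hvi)
      rcases hAdj _ _ hc.closed_getElem with h2 | h2
      exacts [hclast h2, h1 (by simpa using h2)]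
    refine mem_positions.2 ⟨hi1, fun h1 => ?_⟩
    have hR := hc.drop_append_take (i + 1)
    have hRc : (r.drop (i + 1) ++ r.take (i + 1)).Perm r := by
      conv_rhs => rw [← List.take_append_drop (i + 1) r]
      exact List.perm_append_comm
    refine hlast _ hR.reverse ((List.reverse_perm _).trans hRc) ?_ ?_
    · rw [List.getElem_reverse]
      simp only [Nat.sub_zero]
      rwa [getElem_last_rotate hi1]
    · rw [List.getElem_reverse]
      have h2 := getElem_zero_rotate hi1 hR.length_pos
      rw [← h2] at h1
      convert h1 using 2
      have := hR.length_pos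
      rw [List.length_reverse]
      omega
  obtain ⟨s, t, hs, ht, hst⟩ := hA v hv
  have h1 : s.card ≤ (positions r (G.Adj v)).card :=
    card_le_card_positions fun x hx => ⟨hs x hx, hnbr x (hs x hx)⟩
  have h2 : t.card ≤ (positions r (G.Adj v)).card :=
    card_le_card_positions fun x hx => ⟨(ht x hx).1, hnbr x (ht x hx).1⟩
  have h3 := Finset.card_le_card hsucc
  rw [Finset.card_image_of_injective _ (add_left_injective 1)] at h3
  have h4 := card_positions_le_of_subset (P := (· ∉ A)) hc.nodup hperm.subset
  have h5 := h.two_mul_card_positions_notMem_lt hAdj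
  omega

/-- If the vertices of a longest path with ends in `A` can be arranged in a cycle, then no vertex
outside `A` and outside the cycle is adjacent to it. -/
lemma false_of_adj_of_notMem {k : ℕ} (hAdj : ∀ x y, G.Adj x y → x ∈ A ∨ y ∈ A)
    (hB : ∀ v ∉ A, ∃ s : Finset V, (∀ x ∈ s, G.Adj v x) ∧ k + 1 ≤ s.card)
    (hl : l.length ≤ 2 * k)
    (hmax : ∀ l', IsPathBetween G A l' → l'.length ≤ l.length)
    {r : List V} (hc : IsCyclicList G r) (hperm : r.Perm l) {v : V} (hvc : v ∉ r)
    (hadj : G.Adj v (r[0]'hc.length_pos)) (hv : v ∉ A) : False := by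
  have hpos := hc.length_pos
  have hplen := hperm.length_eq
  have hnbrA : ∀ x, G.Adj v x → x ∈ A := fun x hx => (hAdj _ _ hx).resolve_left hv
  have hnbr : ∀ x, G.Adj v x → x ∈ r := fun x hx => by
    by_contra hxc
    by_cases hlast : r[r.length - 1]'(Nat.sub_lt hc.length_pos one_pos) ∈ A
    · have := hmax _ ((hc.isPathBetween (hnbrA _ hadj) hlast).cons_cons (hnbrA x hx) hxc hvc hx.symm
        hadj)
      simp at this
      omega
    · obtain ⟨hlen, hpath⟩ := hc.take hAdj hlast
      have := hmax _ (hpath.cons_cons (hnbrA x hx) (fun hm => hxc (List.take_subset _ _ hm))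
        (fun hm => hvc (List.take_subset _ _ hm)) hx.symm (by simpa using hadj))
      simp at this
      omega
  obtain ⟨s, hs, hcard⟩ := hB v hv
  obtain ⟨i, hi, hvi, hvi1⟩ := exists_succ_of_lt_two_mul_card_positions (l := r) (P := G.Adj v) (by
    have : s.card ≤ (positions r (G.Adj v)).card :=
      card_le_card_positions fun x hx => ⟨hs x hx, hnbr x (hs x hx)⟩
    omega)
  have hR := hc.drop_append_take (i + 1)
  have hRc : (r.drop (i + 1) ++ r.take (i + 1)).Perm r := by
    conv_rhs => rw [← List.take_append_drop (i + 1) r]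
    exact List.perm_append_comm
  have h0 := getElem_zero_rotate hi hR.length_pos
  have h1 := getElem_last_rotate hi (Nat.sub_lt hR.length_pos one_pos)
  generalize r.drop (i + 1) ++ r.take (i + 1) = R at hR hRc h0 h1
  have hRlen := hRc.length_eq
  obtain ⟨j, hj, hj0, hj1⟩ := exists_succ_of_lt_two_mul_card_positions (l := R) (P := (· ∈ A)) (by
    have : s.card ≤ (positions R (· ∈ A)).card :=
      card_le_card_positions fun x hx =>
        ⟨hnbrA x (hs x hx), hRc.mem_iff.2 (hnbr x (hs x hx))⟩
    omega)
  have hpath := hR.isPathBetween (A := A) (h0 ▸ hnbrA _ hvi1) (h1 ▸ hnbrA _ hvi)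
  have := hmax _ (hpath.drop_append_cons_take hj (fun hm => hvc (hRc.mem_iff.1 hm))
    (by rwa [h0]) (by rwa [h1]) hj0 hj1)
  simp at this
  omega

end IsCyclicList

/-- A connected graph with independent complement of `A` and suitable minimum degrees contains a
path on `2k+1` vertices with both ends in `A`. -/
lemma exists_isPathBetween_length_eq [Fintype V] {k : ℕ}
    (hAdj : ∀ x y, G.Adj x y → x ∈ A ∨ y ∈ A)
    (hB : ∀ v ∉ A, ∃ s : Finset V, (∀ x ∈ s, G.Adj v x) ∧ k + 1 ≤ s.card)
    (hA : ∀ v ∈ A, ∃ s t : Finset V, (∀ x ∈ s, G.Adj v x) ∧ (∀ x ∈ t, G.Adj v x ∧ x ∈ A) ∧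
      2 * k ≤ s.card + t.card)
    (hk : 1 ≤ k)
    (hconn : ∀ T : Finset V, T.Nonempty → T ≠ Finset.univ → ∃ v ∉ T, ∃ w ∈ T, G.Adj v w)
    (hcard : 2 * k < Fintype.card V) (hne : A.Nonempty) :
    ∃ l, IsPathBetween G A l ∧ l.length = 2 * k + 1 := by
  classical
  by_contra! hodd
  have hodd' : ∀ m l, IsPathBetween G A l → l.length ≠ 2 * k + 1 + 2 * m := fun m l hl hlen => by
    obtain ⟨l', hl', hlen'⟩ := IsPathBetween.exists_length_eq hAdj (by omega) m l hl hlen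
    exact hodd l' hl' hlen'
  have hsmall : ∀ l, IsPathBetween G A l → l.length ≤ 2 * k := by
    intro l hl
    by_contra! hlt
    rcases Nat.even_or_odd' l.length with ⟨m, hm | hm⟩
    · obtain ⟨l', hl', hlen'⟩ := IsPathBetween.exists_length_eq hAdj (n := 2 * k + 2) (by omega)
        (m - k - 1) l hl (by omega)
      obtain ⟨j, hj, hj1, hj2⟩ := exists_succ_of_lt_two_mul_card_positions (l := l')
          (P := (· ∈ A)) (by
        have h1 := hl'.two_mul_card_positions_notMem_lt hAdj
        have h2 := card_positions_add_card_positions_not (l := l') (· ∈ A)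
        omega)
      exact IsPathBetween.false_of_length_eq_even hAdj hB hA hk hodd (hodd' 1) _ l' hl' hlen' j hj
        hj1 hj2 le_rfl
    · exact hodd' (m - k) l hl (by omega)
  obtain ⟨a, ha⟩ := hne
  have hsingle : IsPathBetween G A [a] := ⟨by simp, .singleton a, by simp, by simpa, by simpa⟩
  obtain ⟨l, hl, hmax⟩ : ∃ l, IsPathBetween G A l ∧
      ∀ l', IsPathBetween G A l' → l'.length ≤ l.length := by
    obtain ⟨l, hl, hlen⟩ := Nat.findGreatest_spec
      (P := fun n => ∃ l, IsPathBetween G A l ∧ l.length = n) (n := 2 * k)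
      (hsmall _ hsingle) ⟨_, hsingle, rfl⟩
    exact ⟨l, hl, fun l' hl' => hlen ▸ Nat.le_findGreatest (hsmall _ hl') ⟨l', hl', rfl⟩⟩
  have hlk := hsmall l hl
  have hhead : ∀ q (hq : IsPathBetween G A q), q.length = l.length →
      ∀ b, G.Adj (q[0]'hq.length_pos) b → b ∈ q := fun q hq hlen b hb =>
    hq.mem_of_adj_head hAdj hB (hsmall _ hq) (fun l'' h'' => hlen ▸ hmax l'' h'') hb
  obtain ⟨r, hr, hperm⟩ := hl.exists_isCyclicList hA hlk (hhead l hl rfl) fun b hb => by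
    simpa using hhead _ hl.reverse (by simp) b (by simpa using hb)
  obtain ⟨v, hv, w, hw, hvw⟩ := hconn r.toFinset ⟨_, List.mem_toFinset.2 (r.head_mem hr.ne_nil)⟩
    fun huniv => by
      have := r.toFinset_card_le
      rw [huniv, Finset.card_univ, hperm.length_eq] at this
      omega
  rw [List.mem_toFinset] at hv hw
  obtain ⟨i, hi, rfl⟩ := List.getElem_of_mem hw
  have hR := hr.drop_append_take i
  have hRr : (r.drop i ++ r.take i).Perm r := by
    conv_rhs => rw [← List.take_append_drop i r]
    exact List.perm_append_comm
  have hadj : G.Adj v ((r.drop i ++ r.take i)[0]'hR.length_pos) := by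
    rwa [IsCyclicList.getElem_zero_rotate hi]
  have hvR := fun hm => hv (hRr.mem_iff.1 hm)
  by_cases hvA : v ∈ A
  · exact hR.false_of_adj_of_mem hAdj hA hl hlk hmax hhead (hRr.trans hperm) hvR hadj hvA
  · exact hR.false_of_adj_of_notMem hAdj hB hlk hmax (hRr.trans hperm) hvR hadj hvA

lemma IsPathBetween.map_val {S : Set V} {l : List S}
    (h : IsPathBetween (G.induce S) (Subtype.val ⁻¹' A) l) :
    IsPathBetween G A (l.map Subtype.val) where
  nodup := h.nodup.map Subtype.val_injective
  chain := (List.isChain_map _).2 h.chain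
  ne_nil := List.map_eq_nil_iff.not.2 h.ne_nil
  head_mem := by rw [List.head_map]; exact h.head_mem
  last_mem := by rw [List.getLast_map]; exact h.last_mem

open Classical in
/-- The number of pairs `(x, y) ∈ S × T` with `x ∈ A` and `x` adjacent to `y`. -/
noncomputable def adjCount (G : SimpleGraph V) (A : Set V) (S T : Finset V) : ℕ :=
  ∑ x ∈ S, ∑ y ∈ T, if x ∈ A ∧ G.Adj x y then 1 else 0

lemma adjCount_union [DecidableEq V] {S T : Finset V} (h : Disjoint S T) :
    adjCount G A (S ∪ T) (S ∪ T) =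
      adjCount G A S S + adjCount G A T T + (adjCount G A S T + adjCount G A T S) := by
  simp only [adjCount, Finset.sum_union h, Finset.sum_add_distrib]
  ring

open Classical in
lemma adjCount_singleton_left (v : V) (T : Finset V) :
    adjCount G A {v} T = (T.filter fun y => v ∈ A ∧ G.Adj v y).card := by
  simp [adjCount]

open Classical in
lemma adjCount_singleton_right (v : V) (S : Finset V) :
    adjCount G A S {v} = (S.filter fun x => x ∈ A ∧ G.Adj x v).card := by
  simp only [adjCount, Finset.sum_singleton, Finset.card_filter]

lemma exists_adj_of_adjCount_pos {S T : Finset V} (h : 0 < adjCount G A S T) :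
    ∃ x ∈ S, ∃ y ∈ T, x ∈ A ∧ G.Adj x y := by
  by_contra! hno
  refine h.ne' (Finset.sum_eq_zero fun x hx => Finset.sum_eq_zero fun y hy => ?_)
  simpa using hno x hx y hy

open Classical in
lemma adjCount_le_of_card_le {k : ℕ} {S : Finset V} (h : S.card ≤ 2 * k) :
    adjCount G A S S ≤ ∑ x ∈ S, if x ∈ A then 2 * k - 1 else k := by
  refine Finset.sum_le_sum fun x hx => ?_
  split_ifs with hxA
  · rw [← Finset.card_filter]
    have : (S.filter fun y => x ∈ A ∧ G.Adj x y) ⊆ S.erase x := fun y hy => by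
      obtain ⟨hyS, -, hadj⟩ := Finset.mem_filter.1 hy
      exact Finset.mem_erase.2 ⟨hadj.ne', hyS⟩
    have := Finset.card_le_card this
    rw [Finset.card_erase_of_mem hx] at this
    omega
  · simp [hxA]

open Classical in
/-- If the complement of `A` is independent and no path with both ends in `A` has `2k+1` vertices,
then the degrees within `S` of the vertices of `A ∩ S` add up to at most
`(2k-1)|A ∩ S| + k|S \ A|`. -/
lemma adjCount_le {k : ℕ} (hAdj : ∀ x y, G.Adj x y → x ∈ A ∨ y ∈ A) (hk : 1 ≤ k)
    (hno : ∀ l, IsPathBetween G A l → l.length ≠ 2 * k + 1) (S : Finset V) :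
    adjCount G A S S ≤ ∑ x ∈ S, if x ∈ A then 2 * k - 1 else k := by
  induction S using Finset.strongInduction with
  | H S ih =>
  by_contra! hlt
  have hsplit : ∀ T ⊆ S, T.Nonempty →
      adjCount G A T T + (∑ x ∈ S \ T, if x ∈ A then 2 * k - 1 else k) +
      (adjCount G A T (S \ T) + adjCount G A (S \ T) T) >
      ∑ x ∈ S, if x ∈ A then 2 * k - 1 else k := by
    intro T hT hTne
    have h1 := adjCount_union (G := G) (A := A) (Finset.disjoint_sdiff (s := T) (t := S))
    rw [Finset.union_sdiff_of_subset hT] at h1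
    have h2 := ih (S \ T) (Finset.sdiff_ssubset hT hTne)
    omega
  have hvertex : ∀ v ∈ S, (if v ∈ A then 2 * k - 1 else k) <
      (S.filter fun y => v ∈ A ∧ G.Adj v y).card + (S.filter fun x => x ∈ A ∧ G.Adj x v).card := by
    intro v hv
    have h1 := hsplit {v} (by simpa) (by simp)
    have h2 : adjCount G A {v} {v} = 0 := by simp [adjCount]
    have h3 := Finset.sum_sdiff (f := fun x => if x ∈ A then 2 * k - 1 else k)
      (Finset.singleton_subset_iff.2 hv)
    rw [Finset.sum_singleton] at h3
    rw [adjCount_singleton_left v (S \ {v}), adjCount_singleton_right v (S \ {v})] at h1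
    have h4 := Finset.card_le_card (Finset.filter_subset_filter (fun y => v ∈ A ∧ G.Adj v y)
      (Finset.sdiff_subset (s := S) (t := {v})))
    have h5 := Finset.card_le_card (Finset.filter_subset_filter (fun x => x ∈ A ∧ G.Adj x v)
      (Finset.sdiff_subset (s := S) (t := {v})))
    omega
  have hcardS : ∀ s ⊆ S, (s.subtype (· ∈ (S : Set V))).card = s.card := fun s hs => by
    rw [Finset.card_subtype, Finset.filter_true_of_mem]
    exact fun x hx => hs hx
  obtain ⟨l, hl, hlen⟩ := exists_isPathBetween_length_eq (G := G.induce (S : Set V))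
    (A := Subtype.val ⁻¹' A) (k := k) (fun x y h => hAdj _ _ h)
    (fun v hv => by
      have h1 := hvertex v v.2
      have hvA : (v : V) ∉ A := hv
      simp only [hvA, if_false, false_and, Finset.filter_false, Finset.card_empty] at h1
      refine ⟨(S.filter fun x => x ∈ A ∧ G.Adj x v).subtype (· ∈ (S : Set V)), fun x hx => ?_, ?_⟩
      · exact (Finset.mem_filter.1 (Finset.mem_subtype.1 hx)).2.2.symm
      · rw [hcardS _ (Finset.filter_subset _ _)]
        omega)
    (fun v hv => by
      have h1 := hvertex v v.2
      have hvA : (v : V) ∈ A := hv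
      rw [if_pos hvA] at h1
      refine ⟨(S.filter fun x => (v : V) ∈ A ∧ G.Adj v x).subtype (· ∈ (S : Set V)),
        (S.filter fun x => x ∈ A ∧ G.Adj x v).subtype (· ∈ (S : Set V)),
        fun x hx => ?_, fun x hx => ?_, ?_⟩
      · exact (Finset.mem_filter.1 (Finset.mem_subtype.1 hx)).2.2
      · have := (Finset.mem_filter.1 (Finset.mem_subtype.1 hx)).2
        exact ⟨this.2.symm, this.1⟩
      · rw [hcardS _ (Finset.filter_subset _ _), hcardS _ (Finset.filter_subset _ _)]
        omega)
    hk
    (fun T hTne hTuniv => by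
      set T' := T.map (Function.Embedding.subtype (· ∈ (S : Set V)))
      have hsub : T' ⊆ S := fun x hx => by
        obtain ⟨y, -, rfl⟩ := Finset.mem_map.1 hx
        exact y.2
      have hne : T' ≠ S := fun heq => hTuniv <| Finset.eq_univ_of_forall fun x => by
        have hx : (x : V) ∈ T' := by rw [heq]; exact x.2
        obtain ⟨y, hy, hyx⟩ := Finset.mem_map.1 hx
        rwa [← Subtype.ext hyx]
      have h1 := hsplit T' hsub hTne.map
      have h2 := ih T' (Finset.ssubset_iff_subset_ne.2 ⟨hsub, hne⟩)
      have h3 := Finset.sum_sdiff (f := fun x => if x ∈ A then 2 * k - 1 else k) hsub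
      have hlift : ∀ x ∈ S \ T', ∀ y ∈ T', G.Adj x y →
          ∃ v ∉ T, ∃ w ∈ T, (G.induce (S : Set V)).Adj v w := by
        intro x hx y hy hxy
        obtain ⟨hxS, hxT⟩ := Finset.mem_sdiff.1 hx
        obtain ⟨w, hw, rfl⟩ := Finset.mem_map.1 hy
        exact ⟨⟨x, hxS⟩, fun hm => hxT (Finset.mem_map_of_mem _ hm), w, hw, hxy⟩
      rcases Nat.eq_zero_or_pos (adjCount G A T' (S \ T')) with h4 | h4
      · obtain ⟨x, hx, y, hy, -, hxy⟩ := exists_adj_of_adjCount_pos (G := G) (A := A)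
          (S := S \ T') (T := T') (by omega)
        exact hlift x hx y hy hxy
      · obtain ⟨y, hy, x, hx, -, hxy⟩ := exists_adj_of_adjCount_pos h4
        exact hlift x hx y hy hxy.symm)
    (by
      by_contra! hle
      exact hlt.not_ge (adjCount_le_of_card_le (by simpa using hle)))
    (by
      obtain ⟨x, hx, h⟩ := exists_adj_of_adjCount_pos (pos_of_gt hlt)
      obtain ⟨-, -, hxA, -⟩ := h
      exact ⟨⟨x, hx⟩, hxA⟩)
  exact hno _ hl.map_val (by simpa using hlen)

/-- A path avoiding `u` on at least two vertices, with both ends adjacent to `u`, closes up to a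
cycle through `u`. -/
lemma exists_isCycle_of_isPathBetween {u : V} (h : IsPathBetween G (G.neighborSet u) l)
    (hlen : 2 ≤ l.length) (hu : u ∉ l) :
    ∃ c : G.Walk u u, c.IsCycle ∧ c.length = l.length + 1 := by
  have hhead : G.Adj u (l.head h.ne_nil) := h.head_mem
  have hlast : G.Adj (l.getLast h.ne_nil) u := G.adj_symm h.last_mem
  let w := Walk.ofSupport l h.ne_nil h.chain
  have hsupp : w.support = l := Walk.support_ofSupport _ _
  have hpath : w.IsPath := (Walk.isPath_def _).2 (by rw [hsupp]; exact h.nodup)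
  have hne : l.head h.ne_nil ≠ l.getLast h.ne_nil := by
    rw [List.head_eq_getElem, List.getLast_eq_getElem, Ne, h.nodup.getElem_inj_iff]
    omega
  refine ⟨Walk.cons hhead (w.concat hlast),
    (Walk.cons_isCycle_iff _ _).2 ⟨hpath.concat (by rwa [hsupp]) _, fun hmem => ?_⟩, ?_⟩
  · rw [Walk.edges_concat, List.concat_eq_append, List.mem_append] at hmem
    rcases hmem with hmem | hmem
    · exact hu (hsupp ▸ w.fst_mem_support_of_mem_edges hmem)
    · rw [List.mem_singleton, Sym2.eq_swap, Sym2.congr_left] at hmem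
      exact hne hmem
  · rw [Walk.length_cons, Walk.length_concat, Walk.length_ofSupport]
    omega

end SimpleGraph

/-- key inequality in the proof of Theorem 2. Let `k ≥ 1` and let `G` be
a graph with `n` vertices containing no cycle of length `2k+2`. Then for every vertex `u`,
`∑_{v ∈ Γ_G(u)} d_G(v) ≤ k·d_G(u) + k(n−1)`. -/
theorem degree_powers_stmt_5 {V : Type*} [Fintype V] [DecidableEq V]
    (G : SimpleGraph V) [DecidableRel G.Adj] (k : ℕ) (hk : 1 ≤ k)
    (hC : ¬ ∃ (u : V) (c : G.Walk u u), c.IsCycle ∧ c.length = 2 * k + 2) :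
    ∀ u : V, ∑ v ∈ G.neighborFinset u, G.degree v
      ≤ k * G.degree u + k * (Fintype.card V - 1) := by
  classical
  intro u
  set A := G.neighborSet u with hA
  let H : SimpleGraph V :=
    { Adj := fun x y => G.Adj x y ∧ x ≠ u ∧ y ≠ u ∧ (x ∈ A ∨ y ∈ A)
      symm := ⟨fun x y h => ⟨h.1.symm, h.2.2.1, h.2.1, h.2.2.2.symm⟩⟩ }
  have hno : ∀ l, H.IsPathBetween A l → l.length ≠ 2 * k + 1 := fun l hl hlen => by
    have hG : G.IsPathBetween A l :=
      ⟨hl.nodup, hl.chain.imp fun _ _ h => h.1, hl.ne_nil, hl.head_mem, hl.last_mem⟩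
    have hul : u ∉ l := fun hm => by
      obtain ⟨i, hi, hiu⟩ := List.getElem_of_mem hm
      by_cases hi1 : i + 1 < l.length
      · exact (hl.adj hi1).2.1 hiu
      · obtain rfl : i = l.length - 1 := by omega
        exact G.irrefl (hiu ▸ hl.getElem_last_mem : u ∈ A)
    obtain ⟨c, hc, hcl⟩ := SimpleGraph.exists_isCycle_of_isPathBetween hG (by omega) hul
    exact hC ⟨u, c, hc, by omega⟩
  have hle : H.adjCount A (Finset.univ.erase u) (Finset.univ.erase u) ≤
      ∑ x ∈ Finset.univ.erase u, if x ∈ A then 2 * k - 1 else k := by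
    convert SimpleGraph.adjCount_le (G := H) (A := A) (fun x y h => h.2.2.2) hk hno
      (Finset.univ.erase u)
  have hfilter : (Finset.univ.erase u).filter (· ∈ A) = G.neighborFinset u := by
    ext x
    simp only [Finset.mem_filter, Finset.mem_erase, Finset.mem_univ, and_true,
      SimpleGraph.mem_neighborFinset, hA, SimpleGraph.mem_neighborSet]
    exact ⟨And.right, fun h => ⟨h.ne', h⟩⟩
  have hdeg : ∀ v ∈ G.neighborFinset u, G.degree v =
      (∑ y ∈ Finset.univ.erase u, if v ∈ A ∧ H.Adj v y then 1 else 0) + 1 := by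
    intro v hv
    rw [SimpleGraph.mem_neighborFinset] at hv
    have hvA : v ∈ A := hv
    have : (Finset.univ.erase u).filter (fun y => v ∈ A ∧ H.Adj v y) =
        (G.neighborFinset v).erase u := by
      ext y
      simp only [Finset.mem_filter, Finset.mem_erase, Finset.mem_univ, and_true,
        SimpleGraph.mem_neighborFinset]
      exact ⟨fun h => ⟨h.1, h.2.2.1⟩, fun h => ⟨h.1, hvA, h.2, hv.ne', h.1, .inl hvA⟩⟩
    rw [← Finset.card_filter, this, Finset.card_erase_add_one (by simpa using hv.symm),
      SimpleGraph.card_neighborFinset_eq_degree]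
  have hsum : H.adjCount A (Finset.univ.erase u) (Finset.univ.erase u) =
      ∑ v ∈ G.neighborFinset u, ∑ y ∈ Finset.univ.erase u,
        if v ∈ A ∧ H.Adj v y then 1 else 0 := by
    rw [← hfilter, Finset.sum_filter]
    refine Finset.sum_congr rfl fun x _ => ?_
    split_ifs with hx
    · exact Finset.sum_congr rfl fun y _ => by congr
    · simp [hx]
  have hcard := Finset.card_filter_add_card_filter_not (s := Finset.univ.erase u) (· ∈ A)
  rw [Finset.sum_ite, Finset.sum_const, Finset.sum_const, hsum, hfilter,
    SimpleGraph.card_neighborFinset_eq_degree, smul_eq_mul, smul_eq_mul] at hle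
  rw [hfilter, SimpleGraph.card_neighborFinset_eq_degree,
    Finset.card_erase_of_mem (Finset.mem_univ u), Finset.card_univ] at hcard
  rw [Finset.sum_congr rfl hdeg, Finset.sum_add_distrib, Finset.sum_const,
    SimpleGraph.card_neighborFinset_eq_degree, smul_eq_mul, ← hcard]
  obtain ⟨j, rfl⟩ : ∃ j, k = j + 1 := ⟨k - 1, by omega⟩
  rw [show 2 * (j + 1) - 1 = 2 * j + 1 by omega] at hle
  linarith
end

section
/- Let G be a finite simple graph whose vertex set is partitioned into two sets A and B, where B is an independent set. If G contains an A-path of order p > 2, then G contains an A-path of order p−2. -/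
/-- The part of a path between its `i`-th and `j`-th vertices is a path of length `j - i`. -/
theorem SimpleGraph.Walk.IsPath.exists_isPath_getVert {V : Type*} {G : SimpleGraph V} {x y : V}
    {w : G.Walk x y} (hw : w.IsPath) {i j : ℕ} (hij : i ≤ j) (hj : j ≤ w.length) :
    ∃ q : G.Walk (w.getVert i) (w.getVert j), q.IsPath ∧ q.length = j - i := by
  have hv : (w.drop i).getVert (j - i) = w.getVert j := by
    rw [SimpleGraph.Walk.drop_getVert]
    congr 1
    omega
  rw [← hv]
  refine ⟨(w.drop i).take (j - i), (hw.drop i).take (j - i), ?_⟩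
  rw [SimpleGraph.Walk.take_length, SimpleGraph.Walk.drop_length]
  omega


/-- Claim 1. Let the vertices of `G` be partitioned into `A` and `B` with
`B` independent. If `G` contains an `A`-path of order `p > 2`, then `G` contains an
`A`-path of order `p − 2`. An `A`-path is a path with both ends in `A`; its order is its
number of vertices, i.e. `length + 1`. -/
theorem degree_powers_stmt_8 {V : Type*} [Fintype V] [DecidableEq V]
    (G : SimpleGraph V) (A B : Finset V)
    (hdisj : Disjoint A B) (hcover : A ∪ B = Finset.univ)
    (hBind : ∀ a ∈ B, ∀ b ∈ B, ¬ G.Adj a b)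
    (p : ℕ) (hp : 2 < p)
    (hpath : ∃ (x y : V) (w : G.Walk x y), w.IsPath ∧ x ∈ A ∧ y ∈ A ∧ w.length + 1 = p) :
    ∃ (x y : V) (w : G.Walk x y), w.IsPath ∧ x ∈ A ∧ y ∈ A ∧ w.length + 1 = p - 2 := by
  obtain ⟨x, y, w, hw, hx, hy, hlen⟩ := hpath
  have mem_of_adj {u v : V} (h : G.Adj u v) (hv : v ∉ A) : u ∈ A := by
    have mem_or (z : V) : z ∈ A ∨ z ∈ B := by
      rw [← Finset.mem_union, hcover]
      exact Finset.mem_univ z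
    by_contra hu
    exact hBind u ((mem_or u).resolve_left hu) v ((mem_or v).resolve_left hv) h
  have shorten {i j : ℕ} (hij : i ≤ j) (hj : j ≤ w.length) (hd : j - i + 2 = w.length)
      (hi : w.getVert i ∈ A) (hjA : w.getVert j ∈ A) :
      ∃ (x y : V) (w : G.Walk x y), w.IsPath ∧ x ∈ A ∧ y ∈ A ∧ w.length + 1 = p - 2 := by
    obtain ⟨q, hq, hql⟩ := hw.exists_isPath_getVert hij hj
    exact ⟨_, _, q, hq, hi, hjA, by omega⟩
  by_cases h2 : w.getVert 2 ∈ A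
  · exact shorten (i := 2) (j := w.length) (by omega) le_rfl (by omega) h2
      (by rwa [w.getVert_length])
  by_cases hn : w.getVert (w.length - 2) ∈ A
  · exact shorten (i := 0) (j := w.length - 2) (by omega) (by omega) (by omega)
      (by rwa [w.getVert_zero]) hn
  have hadj : G.Adj (w.getVert (w.length - 1)) (w.getVert (w.length - 2)) := by
    have h := w.adj_getVert_succ (i := w.length - 2) (by omega)
    rw [show w.length - 2 + 1 = w.length - 1 by omega] at h
    exact h.symm
  exact shorten (i := 1) (j := w.length - 1) (by omega) (by omega) (by omega)
    (mem_of_adj (w.adj_getVert_succ (i := 1) (by omega)) h2) (mem_of_adj hadj hn)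
end

section
/- Let k ≥ 1 be an integer and let G be a finite simple graph whose vertex set is partitioned into two sets A and B, where B is an independent set. If G contains an A-path of order p ≥ 2k, then G contains an A-path of order 2k or of order 2k+1. -/
/-- Claim 3. Let `k ≥ 1` and let the vertices of `G` be partitioned into
`A` and `B` with `B` independent. If `G` contains an `A`-path of order `p ≥ 2k`, then `G`
contains an `A`-path of order `2k` or `2k+1`. -/
theorem degree_powers_stmt_9 {V : Type*} [Fintype V] [DecidableEq V]
    (G : SimpleGraph V) (k : ℕ) (hk : 1 ≤ k) (A B : Finset V)
    (hdisj : Disjoint A B) (hcover : A ∪ B = Finset.univ)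
    (hBind : ∀ a ∈ B, ∀ b ∈ B, ¬ G.Adj a b)
    (p : ℕ) (hp : 2 * k ≤ p)
    (hpath : ∃ (x y : V) (w : G.Walk x y), w.IsPath ∧ x ∈ A ∧ y ∈ A ∧ w.length + 1 = p) :
    ∃ (x y : V) (w : G.Walk x y), w.IsPath ∧ x ∈ A ∧ y ∈ A ∧
      (w.length + 1 = 2 * k ∨ w.length + 1 = 2 * k + 1) := by
  obtain ⟨x, y, w, hw, hx, hy, rfl⟩ := hpath
  have hcov : ∀ v, v ∈ A ∨ v ∈ B := fun v ↦ by
    rw [← Finset.mem_union, hcover]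
    exact Finset.mem_univ v
  by_cases hlen : w.length + 1 = 2 * k
  · exact ⟨x, y, w, hw, hx, hy, Or.inl hlen⟩
  have hadj : G.Adj (w.getVert (2 * k - 1)) (w.getVert (2 * k - 1 + 1)) :=
    w.adj_getVert_succ (by omega)
  rcases hcov (w.getVert (2 * k - 1)) with h | h
  · refine ⟨x, _, w.take (2 * k - 1), hw.take _, hx, h, Or.inl ?_⟩
    rw [SimpleGraph.Walk.take_length]
    omega
  · have h' := (hcov (w.getVert (2 * k - 1 + 1))).resolve_right fun h' ↦ hBind _ h _ h' hadj
    refine ⟨x, _, w.take (2 * k - 1 + 1), hw.take _, hx, h', Or.inr ?_⟩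
    rw [SimpleGraph.Walk.take_length]
    omega
end

section
/- Let k ≥ 1 be an integer and let G be a finite simple graph whose vertex set is partitioned into two sets A and B, where B is an independent set. If G contains an A-path of odd order p ≥ 2k+1, then G contains an A-path of order exactly 2k+1. -/
/-- In a binary word of odd length without two consecutive false letters whose first and last
letters are true, two true letters occur at every admissible even distance `2 * k`. -/
theorem exists_even_gap {P : ℕ → Prop} {k m : ℕ} (hkm : k ≤ m) (h0 : P 0) (hm : P (2 * m))
    (hsucc : ∀ i < 2 * m, P i ∨ P (i + 1)) :
    ∃ i, i + 2 * k ≤ 2 * m ∧ P i ∧ P (i + 2 * k) := by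
  by_contra! h
  have key : ∀ j, j + k ≤ m → P (2 * j) := by
    intro j
    induction j with
    | zero => exact fun _ => h0
    | succ j ih =>
      intro hj
      have h1 := h (2 * j) (by lia) (ih (by lia))
      have h2 := (hsucc (2 * j + 2 * k) (by lia)).resolve_left h1
      have h3 : ¬ P (2 * j + 1) := fun hP =>
        h (2 * j + 1) (by lia) hP (by convert h2 using 1; lia)
      exact (hsucc (2 * j + 1) (by lia)).resolve_left h3
  refine h (2 * (m - k)) (by lia) (key _ (by lia)) ?_
  convert hm using 1
  lia

/-- Claim 5. Let `k ≥ 1` and let the vertices of `G` be partitioned into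
`A` and `B` with `B` independent. If `G` contains an `A`-path of odd order `p ≥ 2k+1`, then
`G` contains an `A`-path of order exactly `2k+1`. -/
theorem degree_powers_stmt_10 {V : Type*} [Fintype V] [DecidableEq V]
    (G : SimpleGraph V) (k : ℕ) (hk : 1 ≤ k) (A B : Finset V)
    (hdisj : Disjoint A B) (hcover : A ∪ B = Finset.univ)
    (hBind : ∀ a ∈ B, ∀ b ∈ B, ¬ G.Adj a b)
    (p : ℕ) (hodd : Odd p) (hp : 2 * k + 1 ≤ p)
    (hpath : ∃ (x y : V) (w : G.Walk x y), w.IsPath ∧ x ∈ A ∧ y ∈ A ∧ w.length + 1 = p) :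
    ∃ (x y : V) (w : G.Walk x y), w.IsPath ∧ x ∈ A ∧ y ∈ A ∧
      w.length + 1 = 2 * k + 1 := by
  obtain ⟨x, y, w, hw, hx, hy, hlen⟩ := hpath
  obtain ⟨m, rfl⟩ := hodd
  have hl : w.length = 2 * m := by lia
  have hAB (v : V) : v ∈ A ∨ v ∈ B := by
    rw [← Finset.mem_union, hcover]
    exact Finset.mem_univ v
  obtain ⟨i, hi, hi₁, hi₂⟩ := exists_even_gap (P := fun i => w.getVert i ∈ A) (k := k) (m := m)
    (by lia) (by simpa using hx) (by simpa [← hl] using hy) fun i him => by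
      by_contra! h
      exact hBind _ ((hAB _).resolve_left h.1) _ ((hAB _).resolve_left h.2)
        (w.adj_getVert_succ (by lia))
  refine ⟨_, _, (w.drop i).take (2 * k), (hw.drop i).take (2 * k), hi₁, ?_, ?_⟩
  · rw [SimpleGraph.Walk.drop_getVert]
    exact hi₂
  · rw [SimpleGraph.Walk.take_length, SimpleGraph.Walk.drop_length]
    lia
end

section
/- Let k ≥ 1 be an integer and let G be a finite simple graph whose vertex set is partitioned into two sets A and B, where B is an independent set. If G contains a cycle of order p for some p ≥ 2k+1, then G contains an A-path of order 2k or of order 2k+1. -/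
/-- Claim 4. Let `k ≥ 1` and let the vertices of `G` be partitioned into
`A` and `B` with `B` independent. If `G` contains a cycle of order `p` for some `p ≥ 2k+1`,
then `G` contains an `A`-path of order `2k` or `2k+1`. The order of a cycle is its number
of vertices, which equals its length as a closed walk. -/
theorem degree_powers_stmt_11 {V : Type*} [Fintype V] [DecidableEq V]
    (G : SimpleGraph V) (k : ℕ) (hk : 1 ≤ k) (A B : Finset V)
    (hdisj : Disjoint A B) (hcover : A ∪ B = Finset.univ)
    (hBind : ∀ a ∈ B, ∀ b ∈ B, ¬ G.Adj a b)
    (p : ℕ) (hp : 2 * k + 1 ≤ p)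
    (hcyc : ∃ (x : V) (c : G.Walk x x), c.IsCycle ∧ c.length = p) :
    ∃ (x y : V) (w : G.Walk x y), w.IsPath ∧ x ∈ A ∧ y ∈ A ∧
      (w.length + 1 = 2 * k ∨ w.length + 1 = 2 * k + 1) := by
  obtain ⟨x, c, hc, hlen⟩ := hcyc
  have mem_A_of_notMem_B : ∀ v, v ∉ B → v ∈ A := fun v hv => by
    have h := Finset.mem_univ v
    rw [← hcover, Finset.mem_union] at h
    exact h.resolve_right hv
  have succ_mem : ∀ {u : V} (d : G.Walk u u) (n : ℕ), n < d.length →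
      d.getVert n ∈ A ∨ d.getVert (n + 1) ∈ A := fun d n hn => by
    by_contra! h
    exact hBind _ (by_contra fun hB => h.1 (mem_A_of_notMem_B _ hB)) _
      (by_contra fun hB => h.2 (mem_A_of_notMem_B _ hB)) (d.adj_getVert_succ hn)
  obtain ⟨a, ha, d, hd, hdlen⟩ : ∃ a ∈ A, ∃ d : G.Walk a a, d.IsCycle ∧ d.length = p := by
    have key : ∀ n, c.getVert n ∈ A → ∃ a ∈ A, ∃ d : G.Walk a a, d.IsCycle ∧ d.length = p :=
      fun n hn => ⟨_, hn, c.rotate _ (c.getVert_mem_support n), hc.rotate _, by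
        rw [SimpleGraph.Walk.length_rotate, hlen]⟩
    exact (succ_mem c 0 (by omega)).elim (key 0) (key 1)
  have take_path : ∀ n, n < p → d.getVert n ∈ A → (n + 1 = 2 * k ∨ n + 1 = 2 * k + 1) →
      ∃ (x y : V) (w : G.Walk x y), w.IsPath ∧ x ∈ A ∧ y ∈ A ∧
        (w.length + 1 = 2 * k ∨ w.length + 1 = 2 * k + 1) := fun n hn hA h =>
    ⟨_, _, d.take n, hd.isPath_take (by omega), ha, hA, by
      rwa [SimpleGraph.Walk.take_length, min_eq_left (by omega)]⟩
  rcases succ_mem d (2 * k - 1) (by omega) with h | h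
  · exact take_path _ (by omega) h (by omega)
  · exact take_path _ (by omega) h (by omega)
end

section
/- Let k ≥ 1 be an integer and let G be a finite simple graph whose vertex set is partitioned into two sets A and B, where B is an independent set. If G contains a cycle of order p for some p ≥ 2k+1, then G contains an A-path of order exactly 2k+1. -/
/-- A sequence of successively adjacent vertices, without repetition on the window
`[i, i + n]`, spans a path of length `n`. -/
theorem SimpleGraph.exists_isPath_of_adj_succ {V : Type*} (G : SimpleGraph V) (f : ℕ → V)
    (hadj : ∀ i, G.Adj (f i) (f (i + 1))) (i n : ℕ)
    (hinj : Set.InjOn f (Set.Icc i (i + n))) :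
    ∃ w : G.Walk (f i) (f (i + n)), w.IsPath ∧ w.length = n ∧
      ∀ v ∈ w.support, ∃ j ∈ Set.Icc i (i + n), f j = v := by
  induction n with
  | zero => exact ⟨.nil, by simp, by simp, by simp⟩
  | succ n ih =>
    obtain ⟨w, hw, hl, hs⟩ := ih (hinj.mono (Set.Icc_subset_Icc_right (by omega)))
    refine ⟨w.concat (hadj (i + n)), hw.concat ?_ (hadj (i + n)), by simp [hl], ?_⟩
    · intro hmem
      obtain ⟨j, hj, hjv⟩ := hs _ hmem
      simp only [Set.mem_Icc] at hj
      have := hinj (Set.mem_Icc.2 ⟨hj.1, by omega⟩) (Set.mem_Icc.2 ⟨by omega, by omega⟩) hjv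
      omega
    · intro v hv
      rw [SimpleGraph.Walk.support_concat, List.mem_append, List.mem_singleton] at hv
      rcases hv with hv | rfl
      · obtain ⟨j, hj, hjv⟩ := hs v hv
        exact ⟨j, ⟨hj.1, by have := hj.2; omega⟩, hjv⟩
      · exact ⟨i + (n + 1), ⟨by omega, le_rfl⟩, rfl⟩

/-- The vertices of a cycle of length `p`, listed periodically, form a sequence of successively
adjacent vertices that only repeats at distance a multiple of `p`. -/
theorem SimpleGraph.Walk.IsCycle.exists_periodic_enumeration {V : Type*} {G : SimpleGraph V}
    {x : V} {c : G.Walk x x} (hc : c.IsCycle) :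
    ∃ f : ℕ → V, (∀ i, G.Adj (f i) (f (i + 1))) ∧
      ∀ i j, f i = f j → i ≡ j [MOD c.length] := by
  have hpos : 0 < c.length := by have := hc.three_le_length; omega
  refine ⟨fun i => c.getVert (i % c.length), fun i => ?_, fun i j hij => ?_⟩
  · have hlt := Nat.mod_lt i hpos
    have hadj := c.adj_getVert_succ hlt
    have hsucc : c.getVert ((i + 1) % c.length) = c.getVert (i % c.length + 1) := by
      rw [← Nat.mod_add_mod]
      rcases Nat.lt_or_ge (i % c.length + 1) c.length with h | h
      · rw [Nat.mod_eq_of_lt h]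
      · have : i % c.length + 1 = c.length := by omega
        simp [this]
    simpa only [hsucc] using hadj
  · have hi := Nat.mod_lt i hpos
    have hj := Nat.mod_lt j hpos
    exact hc.getVert_injOn' (by simp only [Set.mem_ofPred_eq]; omega)
      (by simp only [Set.mem_ofPred_eq]; omega) hij

/-- If, among consecutive naturals, at least one satisfies `P`, then `P` holds at two naturals at
distance `2 * k`. -/
theorem exists_and_add_two_mul (P : ℕ → Prop) (h : ∀ i, P i ∨ P (i + 1)) (k : ℕ) :
    ∃ i, P i ∧ P (i + 2 * k) := by
  by_contra! hne
  have halt : ∀ i, P i → ¬ P (i + 1) := by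
    intro i hi hi'
    have h₁ := hne i hi
    have h₂ := hne (i + 1) hi'
    rw [Nat.add_right_comm] at h₂
    exact (h (i + 2 * k)).elim h₁ h₂
  have hstep : ∀ m i, P i → P (i + 2 * m) := by
    intro m i hi
    induction m with
    | zero => exact hi
    | succ m ih => exact (h (i + 2 * m + 1)).resolve_left (halt _ ih)
  rcases h 0 with h | h
  · exact hne _ h (hstep k _ h)
  · exact hne _ h (hstep k _ h)


/-- Claim 6. Let `k ≥ 1` and let the vertices of `G` be partitioned into
`A` and `B` with `B` independent. If `G` contains a cycle of order `p` for some `p ≥ 2k+1`,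
then `G` contains an `A`-path of order exactly `2k+1`. -/
theorem degree_powers_stmt_12 {V : Type*} [Fintype V] [DecidableEq V]
    (G : SimpleGraph V) (k : ℕ) (hk : 1 ≤ k) (A B : Finset V)
    (hdisj : Disjoint A B) (hcover : A ∪ B = Finset.univ)
    (hBind : ∀ a ∈ B, ∀ b ∈ B, ¬ G.Adj a b)
    (p : ℕ) (hp : 2 * k + 1 ≤ p)
    (hcyc : ∃ (x : V) (c : G.Walk x x), c.IsCycle ∧ c.length = p) :
    ∃ (x y : V) (w : G.Walk x y), w.IsPath ∧ x ∈ A ∧ y ∈ A ∧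
      w.length + 1 = 2 * k + 1 := by
  obtain ⟨x, c, hc, rfl⟩ := hcyc
  obtain ⟨f, hadj, hf⟩ := hc.exists_periodic_enumeration
  have hA : ∀ i, f i ∈ A ∨ f (i + 1) ∈ A := by
    intro i
    by_contra! hne
    have hB : ∀ v, v ∉ A → v ∈ B := fun v hv =>
      (Finset.mem_union.1 (hcover ▸ Finset.mem_univ v)).resolve_left hv
    exact hBind _ (hB _ hne.1) _ (hB _ hne.2) (hadj i)
  obtain ⟨i, hi, hi'⟩ := exists_and_add_two_mul (fun i => f i ∈ A) hA k
  have hinj : Set.InjOn f (Set.Icc i (i + 2 * k)) := by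
    intro a ha b hb hab
    simp only [Set.mem_Icc] at ha hb
    have hmod := hf a b hab
    rcases le_total a b with hle | hle
    · have := Nat.eq_zero_of_dvd_of_lt ((Nat.modEq_iff_dvd' hle).1 hmod) (by omega)
      omega
    · have := Nat.eq_zero_of_dvd_of_lt ((Nat.modEq_iff_dvd' hle).1 hmod.symm) (by omega)
      omega
  obtain ⟨w, hw, hl, -⟩ := G.exists_isPath_of_adj_succ f hadj i (2 * k) hinj
  exact ⟨_, _, w, hw, hi, hi', by omega⟩
end

section
/- Let k ≥ 1 be an integer and let G be a finite simple graph of order n containing no cycle of length 2k+2. If μ is the largest eigenvalue of the adjacency matrix of G, then μ² − k·μ ≤ k(n−1). -/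
open scoped Matrix

/-- The clockwise distance from position `a` to position `b` on a circle with `n` positions. -/
def clockwiseDist (n a b : ℕ) : ℕ := if a ≤ b then b - a else n + b - a

section ClockwiseDist

variable {n a b c d : ℕ}

lemma clockwiseDist_self : clockwiseDist n a a = 0 := by
  simp [clockwiseDist]

lemma clockwiseDist_left_inj (ha : a < n) (hb : b < n)
    (h : clockwiseDist n a c = clockwiseDist n b c) : a = b := by
  unfold clockwiseDist at h
  split_ifs at h <;> omega

lemma clockwiseDist_right_inj (ha : a < n) (hb : b < n) (hc : c < n)
    (h : clockwiseDist n c a = clockwiseDist n c b) : a = b := by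
  unfold clockwiseDist at h
  split_ifs at h <;> omega

lemma clockwiseDist_le_of_left_lt (ha : a < n) (hb : b < n) (hd : d < n)
    (hx : clockwiseDist n a d ≤ clockwiseDist n a b)
    (h : clockwiseDist n a b < clockwiseDist n c b) :
    d ≠ c ∧ clockwiseDist n c d ≤ clockwiseDist n c b := by
  unfold clockwiseDist at *
  split_ifs at * <;> omega

lemma clockwiseDist_le_of_right_lt
    (hx : clockwiseDist n a d ≤ clockwiseDist n a b)
    (h : clockwiseDist n a b < clockwiseDist n a c) :
    d ≠ c ∧ clockwiseDist n a d ≤ clockwiseDist n a c :=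
  ⟨by rintro rfl; omega, by omega⟩

end ClockwiseDist

lemma Finset.card_le_card_filter_nonmax_add {α β : Type*} (S : Finset α)
    (T : Finset β) (key : α → β) (w : α → ℕ) (hT : ∀ a ∈ S, key a ∈ T)
    (hw : ∀ a b, key a = key b → w a = w b → a = b)
    [DecidablePred fun a => ∃ b ∈ S, key b = key a ∧ w a < w b] :
    S.card ≤ (S.filter fun a => ∃ b ∈ S, key b = key a ∧ w a < w b).card + T.card := by
  rw [← Finset.card_filter_add_card_filter_not (s := S)
    (fun a => ∃ b ∈ S, key b = key a ∧ w a < w b)]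
  gcongr
  refine Finset.card_le_card_of_injOn key
    (fun a ha => hT a (Finset.mem_filter.1 ha).1) fun a ha b hb hab => hw a b hab ?_
  rw [Finset.mem_coe, Finset.mem_filter] at ha hb
  have h₁ : ¬ w a < w b := fun h => ha.2 ⟨b, hb.1, hab.symm, h⟩
  have h₂ : ¬ w b < w a := fun h => hb.2 ⟨a, ha.1, hab, h⟩
  omega

namespace SimpleGraph

section Zigzag

variable {V : Type*} {G : SimpleGraph V} {n : ℕ} {pos : V → ℕ} {A R : Finset V}

/-- There is a path of length `m` from `v` to a vertex of `A`, all of whose vertices lie in `R`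
and on the clockwise arc from `e.1` to `e.2`. -/
def ArcPath (G : SimpleGraph V) (n : ℕ) (pos : V → ℕ) (A R : Finset V) (m : ℕ) (e : V × V)
    (v : V) : Prop :=
  ∃ x ∈ A, ∃ p : G.Walk v x, p.IsPath ∧ p.length = m ∧ ∀ y ∈ p.support, y ∈ R ∧
    clockwiseDist n (pos e.1) (pos y) ≤ clockwiseDist n (pos e.1) (pos e.2)

lemma ArcPath.cons {m : ℕ} {e e' : V × V} {v w : V} (h : ArcPath G n pos A R m e v)
    (hwv : G.Adj w v) (hw : w ∈ R)
    (hwe : clockwiseDist n (pos e'.1) (pos w) ≤ clockwiseDist n (pos e'.1) (pos e'.2))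
    (he : ∀ y, clockwiseDist n (pos e.1) (pos y) ≤ clockwiseDist n (pos e.1) (pos e.2) →
      pos y ≠ pos w ∧
      clockwiseDist n (pos e'.1) (pos y) ≤ clockwiseDist n (pos e'.1) (pos e'.2)) :
    ArcPath G n pos A R (m + 1) e' w := by
  obtain ⟨x, hx, p, hp, hm, hs⟩ := h
  refine ⟨x, hx, Walk.cons hwv p, ?_, by simp [hm], ?_⟩
  · exact (Walk.cons_isPath_iff _ _).2 ⟨hp, fun hmem => (he w (hs w hmem).2).1 rfl⟩
  · intro y hy
    rw [Walk.support_cons, List.mem_cons] at hy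
    rcases hy with rfl | hy
    · exact ⟨hw, hwe⟩
    · exact ⟨(hs y hy).1, (he y (hs y hy).2).2⟩

variable (hpos : Function.Injective pos) (hn : ∀ v, pos v < n) (hAR : A ⊆ R)
include hpos hn

include hAR in
lemma exists_arcPath_left_of_right {m N : ℕ}
    (ih : ∀ S : Finset (V × V), (∀ e ∈ S, G.Adj e.1 e.2 ∧ e.1 ∈ A ∧ e.2 ∈ R) → N < S.card →
      ∃ e ∈ S, ArcPath G n pos A R m e e.2)
    (S : Finset (V × V)) (hS : ∀ e ∈ S, G.Adj e.1 e.2 ∧ e.1 ∈ A ∧ e.2 ∈ R)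
    (hN : N + R.card < S.card) : ∃ e ∈ S, ArcPath G n pos A R (m + 1) e e.1 := by
  classical
  have hcard := S.card_le_card_filter_nonmax_add R Prod.snd
    (fun e => clockwiseDist n (pos e.1) (pos e.2)) (fun e he => (hS e he).2.2) (by
      rintro ⟨a, c⟩ ⟨b, d⟩ rfl hab
      exact Prod.ext (hpos (clockwiseDist_left_inj (hn _) (hn _) hab)) rfl)
  obtain ⟨e, he, hpath⟩ := ih _ (fun e he => hS e (Finset.mem_filter.1 he).1)
    (lt_of_add_lt_add_right (hN.trans_le hcard))
  obtain ⟨⟨a, c⟩, he', hc, hlt⟩ := (Finset.mem_filter.1 he).2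
  obtain ⟨b, c'⟩ := e
  obtain rfl : c = c' := hc
  exact ⟨(a, c), he', hpath.cons (hS _ he').1 (hAR (hS _ he').2.1)
    (by simp [clockwiseDist_self]) fun y hy =>
      clockwiseDist_le_of_left_lt (hn _) (hn _) (hn _) hy hlt⟩

lemma exists_arcPath_right_of_left {m N : ℕ}
    (ih : ∀ S : Finset (V × V), (∀ e ∈ S, G.Adj e.1 e.2 ∧ e.1 ∈ A ∧ e.2 ∈ R) → N < S.card →
      ∃ e ∈ S, ArcPath G n pos A R m e e.1)
    (S : Finset (V × V)) (hS : ∀ e ∈ S, G.Adj e.1 e.2 ∧ e.1 ∈ A ∧ e.2 ∈ R)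
    (hN : N + A.card < S.card) : ∃ e ∈ S, ArcPath G n pos A R (m + 1) e e.2 := by
  classical
  have hcard := S.card_le_card_filter_nonmax_add A Prod.fst
    (fun e => clockwiseDist n (pos e.1) (pos e.2)) (fun e he => (hS e he).2.1) (by
      rintro ⟨a, c⟩ ⟨b, d⟩ rfl hab
      exact Prod.ext rfl (hpos (clockwiseDist_right_inj (hn _) (hn _) (hn _) hab)))
  obtain ⟨e, he, hpath⟩ := ih _ (fun e he => hS e (Finset.mem_filter.1 he).1)
    (lt_of_add_lt_add_right (hN.trans_le hcard))
  obtain ⟨⟨a, c⟩, he', ha, hlt⟩ := (Finset.mem_filter.1 he).2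
  obtain ⟨a', b⟩ := e
  obtain rfl : a = a' := ha
  exact ⟨(a, c), he', hpath.cons (hS _ he').1.symm (hS _ he').2.2 le_rfl fun y hy =>
      clockwiseDist_le_of_right_lt hy hlt⟩

include hAR in
lemma exists_arcPath_right (j : ℕ) (S : Finset (V × V))
    (hS : ∀ e ∈ S, G.Adj e.1 e.2 ∧ e.1 ∈ A ∧ e.2 ∈ R)
    (hj : j * (R.card + A.card) < S.card) :
    ∃ e ∈ S, ArcPath G n pos A R (2 * j + 1) e e.2 := by
  induction j generalizing S with
  | zero =>
    obtain ⟨e, he⟩ := Finset.card_pos.1 (by simpa using hj)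
    obtain ⟨hadj, hA, hR⟩ := hS e he
    refine ⟨e, he, e.1, hA, hadj.symm.toWalk, ?_, by simp, ?_⟩
    · simp [Walk.cons_isPath_iff, hadj.ne']
    · simp [hR, hAR hA, clockwiseDist_self]
  | succ j ih =>
    exact exists_arcPath_right_of_left hpos hn
      (exists_arcPath_left_of_right hpos hn hAR ih) S hS (by rw [add_mul] at hj; omega)

end Zigzag

/-- If the edges starting in `A` and ending in `R ⊇ A` are numerous, there is a path of length
`2 * j + 2` inside `R` with both ends in `A`. -/
lemma exists_isPath_of_card_lt {V : Type*} [Fintype V] {G : SimpleGraph V} {A R : Finset V}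
    (hAR : A ⊆ R) (j : ℕ) (S : Finset (V × V))
    (hS : ∀ e ∈ S, G.Adj e.1 e.2 ∧ e.1 ∈ A ∧ e.2 ∈ R)
    (hj : j * A.card + (j + 1) * R.card < S.card) :
    ∃ a ∈ A, ∃ b ∈ A, ∃ p : G.Walk a b, p.IsPath ∧ p.length = 2 * j + 2 ∧
      ∀ y ∈ p.support, y ∈ R := by
  have hpos : Function.Injective fun v => (Fintype.equivFin V v : ℕ) :=
    Fin.val_injective.comp (Fintype.equivFin V).injective
  obtain ⟨e, he, x, hx, p, hp, hm, hs⟩ := exists_arcPath_left_of_right hpos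
    (fun v => (Fintype.equivFin V v).isLt) hAR
    (exists_arcPath_right hpos (fun v => (Fintype.equivFin V v).isLt) hAR j) S hS (by linarith)
  exact ⟨e.1, (hS e he).2.1, x, hx, p, hp, hm, fun y hy => (hs y hy).1⟩

lemma exists_isCycle_of_isPath {V : Type*} {G : SimpleGraph V} {u a b : V} (p : G.Walk a b)
    (hp : p.IsPath) (ha : G.Adj u a) (hb : G.Adj u b) (hab : a ≠ b) (hu : u ∉ p.support) :
    ∃ c : G.Walk u u, c.IsCycle ∧ c.length = p.length + 2 := by
  refine ⟨Walk.cons ha (p.concat hb.symm), ?_, by simp⟩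
  rw [Walk.cons_isCycle_iff]
  refine ⟨hp.concat hu hb.symm, ?_⟩
  rw [Walk.edges_concat, List.concat_eq_append, List.mem_append, not_or]
  refine ⟨fun h => hu (p.fst_mem_support_of_mem_edges h), ?_⟩
  have := ha.ne
  have := hb.ne
  simp_all

lemma sum_degree_neighborFinset_le {V : Type*} [Fintype V] [DecidableEq V]
    (G : SimpleGraph V) [DecidableRel G.Adj] (k : ℕ) (hk : 1 ≤ k)
    (hC : ¬ ∃ (u : V) (c : G.Walk u u), c.IsCycle ∧ c.length = 2 * k + 2) (u : V) :
    ∑ v ∈ G.neighborFinset u, G.degree v ≤ k * G.degree u + k * (Fintype.card V - 1) := by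
  obtain ⟨j, rfl⟩ := Nat.exists_eq_add_of_le' hk
  set A := G.neighborFinset u with hA
  set R := (Finset.univ : Finset V).erase u with hR
  set S := (A.sigma fun v => (G.neighborFinset v).erase u).map
    (Equiv.sigmaEquivProd V V).toEmbedding with hS
  have hAR : A ⊆ R := fun v hv => by
    have := ((G.mem_neighborFinset u v).1 hv).ne'
    simp [hR, this]
  have hScard : ∑ v ∈ A, G.degree v = S.card + G.degree u := by
    rw [hS, Finset.card_map, Finset.card_sigma, ← G.card_neighborFinset_eq_degree u,
      Finset.card_eq_sum_ones, ← Finset.sum_add_distrib]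
    refine Finset.sum_congr rfl fun v hv => ?_
    rw [Finset.card_erase_add_one, card_neighborFinset_eq_degree]
    exact (G.mem_neighborFinset v u).2 ((G.mem_neighborFinset u v).1 hv).symm
  have hSle : S.card ≤ j * A.card + (j + 1) * R.card := by
    by_contra! hlt
    obtain ⟨a, ha, b, hb, p, hp, hlen, hsupp⟩ := exists_isPath_of_card_lt (G := G) hAR j S
      (by
        intro e he
        simp only [hS, Finset.mem_map_equiv, Finset.mem_sigma, Finset.mem_erase,
          mem_neighborFinset] at he
        exact ⟨he.2.2, he.1, by simpa [hR] using he.2.1⟩) hlt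
    have hab : a ≠ b := by
      rintro rfl
      have := Walk.length_eq_zero_iff.2 (Walk.isPath_iff_nil.1 hp)
      omega
    obtain ⟨c, hc, hclen⟩ := exists_isCycle_of_isPath p hp ((G.mem_neighborFinset u a).1 ha)
      ((G.mem_neighborFinset u b).1 hb) hab fun h => by simpa [hR] using hsupp u h
    exact hC ⟨u, c, hc, by omega⟩
  rw [hR, Finset.card_erase_of_mem (Finset.mem_univ u), Finset.card_univ, hA,
    card_neighborFinset_eq_degree] at hSle
  linarith

end SimpleGraph

lemma Matrix.IsSymm.posSemidef_smul_one_sub {V : Type*} [Fintype V] [DecidableEq V]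
    {M : Matrix V V ℝ} (hM : M.IsSymm) {μ : ℝ}
    (hμ : μ ∈ upperBounds {x : ℝ | Module.End.HasEigenvalue (Matrix.toLin' M) x}) :
    (μ • (1 : Matrix V V ℝ) - M).PosSemidef := by
  have hH : (μ • (1 : Matrix V V ℝ) - M).IsHermitian := by
    rw [Matrix.IsHermitian, Matrix.conjTranspose_eq_transpose_of_trivial]
    simp [hM.eq]
  rw [hH.posSemidef_iff_eigenvalues_nonneg]
  intro i
  have hv := hH.mulVec_eigenvectorBasis i
  have hne : (hH.eigenvectorBasis i : V → ℝ) ≠ 0 := fun h =>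
    hH.eigenvectorBasis.toBasis.ne_zero i (by
      ext j
      simpa using congrFun h j)
  have := hμ (a := μ - hH.eigenvalues i) (Module.End.hasEigenvalue_of_hasEigenvector
    (x := (hH.eigenvectorBasis i : V → ℝ)) ⟨by
      rw [Module.End.mem_eigenspace_iff, Matrix.toLin'_apply, sub_smul, ← hv, Matrix.sub_mulVec,
        Matrix.smul_mulVec, Matrix.one_mulVec]
      abel, hne⟩)
  simpa using this

/-- The largest eigenvalue of a nonnegative symmetric matrix has a nonnegative eigenvector. -/
lemma Matrix.IsSymm.exists_nonneg_eigenvector {V : Type*} [Fintype V] [DecidableEq V]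
    {M : Matrix V V ℝ} (hM : M.IsSymm) (hM₀ : ∀ i j, 0 ≤ M i j) {μ : ℝ}
    (hμ : IsGreatest {x : ℝ | Module.End.HasEigenvalue (Matrix.toLin' M) x} μ) :
    ∃ y : V → ℝ, (∀ i, 0 ≤ y i) ∧ y ≠ 0 ∧ M *ᵥ y = μ • y := by
  obtain ⟨x, hx, hx₀⟩ := hμ.1.exists_hasEigenvector
  rw [Module.End.mem_eigenspace_iff, Matrix.toLin'_apply] at hx
  have hpsd := hM.posSemidef_smul_one_sub hμ.2
  have hle : x ⬝ᵥ M *ᵥ x ≤ |x| ⬝ᵥ M *ᵥ |x| := by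
    simp only [dotProduct, Matrix.mulVec, Finset.mul_sum]
    refine Finset.sum_le_sum fun i _ => Finset.sum_le_sum fun j _ => ?_
    calc x i * (M i j * x j) ≤ |x i * (M i j * x j)| := le_abs_self _
      _ = |x| i * (M i j * |x| j) := by simp [abs_mul, abs_of_nonneg (hM₀ i j)]
  have habs : |x| ⬝ᵥ |x| = x ⬝ᵥ x := by
    simp [dotProduct]
  rw [hx, dotProduct_smul, ← habs] at hle
  have hmul : (μ • (1 : Matrix V V ℝ) - M) *ᵥ |x| = μ • |x| - M *ᵥ |x| := by
    rw [Matrix.sub_mulVec, Matrix.smul_mulVec, Matrix.one_mulVec]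
  have hzero : star |x| ⬝ᵥ (μ • (1 : Matrix V V ℝ) - M) *ᵥ |x| = 0 := by
    refine le_antisymm ?_ (hpsd.dotProduct_mulVec_nonneg _)
    rw [hmul, star_trivial, dotProduct_sub, dotProduct_smul]
    linarith
  rw [hpsd.dotProduct_mulVec_zero_iff, hmul, sub_eq_zero] at hzero
  exact ⟨|x|, fun i => abs_nonneg (x i), by simpa using hx₀, hzero.symm⟩


/-- spectral bound from [Nik08]. Let `k ≥ 1` and let `G` be a graph of
order `n` containing no cycle of length `2k+2`. If `μ` is the largest eigenvalue of the
adjacency matrix of `G`, then `μ² − kμ ≤ k(n−1)`. -/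
theorem degree_powers_stmt_16 {V : Type*} [Fintype V] [DecidableEq V]
    (G : SimpleGraph V) [DecidableRel G.Adj] (k : ℕ) (hk : 1 ≤ k)
    (hC : ¬ ∃ (u : V) (c : G.Walk u u), c.IsCycle ∧ c.length = 2 * k + 2)
    (μ : ℝ)
    (hμ : IsGreatest
      {x : ℝ | Module.End.HasEigenvalue (Matrix.toLin' (G.adjMatrix ℝ)) x} μ) :
    μ ^ 2 - k * μ ≤ k * ((Fintype.card V : ℝ) - 1) := by
  obtain ⟨y, hy₀, hy, hyμ⟩ := (G.isSymm_adjMatrix (α := ℝ)).exists_nonneg_eigenvector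
    (fun i j => by rw [SimpleGraph.adjMatrix_apply]; split_ifs <;> norm_num) hμ
  have hswap (f : V → ℝ) : y ⬝ᵥ G.adjMatrix ℝ *ᵥ f = μ * (y ⬝ᵥ f) := by
    rw [Matrix.dotProduct_mulVec, ← Matrix.mulVec_transpose, SimpleGraph.transpose_adjMatrix, hyμ,
      smul_dotProduct, smul_eq_mul]
  have hpos : 0 < y ⬝ᵥ (1 : V → ℝ) := by
    rw [dotProduct_one]
    obtain ⟨i, hi⟩ := Function.ne_iff.1 hy
    exact Finset.sum_pos' (fun i _ => hy₀ i)
      ⟨i, Finset.mem_univ i, lt_of_le_of_ne (hy₀ i) (Ne.symm hi)⟩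
  have hrow : y ⬝ᵥ G.adjMatrix ℝ *ᵥ G.adjMatrix ℝ *ᵥ 1 ≤
      y ⬝ᵥ ((k : ℝ) • (G.adjMatrix ℝ *ᵥ 1) + (k * ((Fintype.card V : ℝ) - 1)) • 1) := by
    refine Finset.sum_le_sum fun u _ => mul_le_mul_of_nonneg_left ?_ (hy₀ u)
    have hcard : 1 ≤ Fintype.card V := Fintype.card_pos_iff.2 ⟨u⟩
    have h := G.sum_degree_neighborFinset_le k hk hC u
    rw [← Nat.cast_le (α := ℝ)] at h
    push_cast [Nat.cast_sub hcard] at h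
    simpa [SimpleGraph.adjMatrix_mulVec_apply] using h
  rw [dotProduct_add, dotProduct_smul, dotProduct_smul, hswap, hswap, smul_eq_mul, smul_eq_mul]
    at hrow
  refine le_of_mul_le_mul_right ?_ hpos
  linarith
end
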